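/- arXiv:math/0212147 — 2 statements merged into one kernel-verified Lean document; each statement's English description precedes it below -/
import Mathlib

section
/- R̂ gives a well-defined map X₀₀ → ℂ/2π²ℤ (the value on each sheet being the corresponding analytic continuation, compatible modulo 2π²ℤ with the identifications defining X₀₀), and R̂ vanishes modulo 2π²ℤ on every defining relation of êêP(ℂ), hence induces a group homomorphism R̂ : êêP(ℂ) → ℂ/2π²ℤ. -/
open Complex
open scoped Classical

noncomputable section

namespace ExtendedBloch

/-- `π` as a complex number. -/
def Cpi : ℂ := (Real.pi : ℂ)

/-- Membership in `ℂ ∖ {0,1}`. -/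
def Reg (z : ℂ) : Prop := z ≠ 0 ∧ z ≠ 1

/-- The open upper half plane. -/
def UHP : Set ℂ := {z : ℂ | 0 < z.im}

/-- The 5-tuple occurring in the five term relation. -/
def ftTuple (x y : ℂ) : Fin 5 → ℂ :=
  ![x, y, y / x, (1 - x⁻¹) / (1 - y⁻¹), (1 - x) / (1 - y)]

/-- The set `FT` of five term tuples. -/
def FT : Set (Fin 5 → ℂ) :=
  {v | ∃ x y : ℂ, Reg x ∧ Reg y ∧ x ≠ y ∧ v = ftTuple x y}

/-- The subset `FT⁺` of tuples with all coordinates in the upper half plane. -/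
def FTplus : Set (Fin 5 → ℂ) := {v | v ∈ FT ∧ ∀ i, v i ∈ UHP}

/-- The point `(z; p, q)` of the cover `𝓒` of `ℂ ∖ {0,1}`, realized concretely as the pair of
branch values `(log z + pπi, -log(1-z) + qπi)` (Riemann surface model of `𝓒`). -/
def pt (z : ℂ) (p q : ℤ) : ℂ × ℂ :=
  (Complex.log z + p * (Cpi * I), -Complex.log (1 - z) + q * (Cpi * I))

/-- The cover `𝓒`, realized as the Riemann surface of all branches of
`(log z + pπi, -log(1-z) + qπi)` on `ℂ ∖ {0,1}`. -/
def Cover : Set (ℂ × ℂ) := {w | ∃ z : ℂ, Reg z ∧ ∃ p q : ℤ, w = pt z p q}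

lemma pt_mem_Cover {z : ℂ} (h : Reg z) (p q : ℤ) : pt z p q ∈ Cover :=
  ⟨z, h, p, q, rfl⟩

/-- `w ∈ 𝓒` lies over `z ∈ ℂ ∖ {0,1}`. -/
def LiesOver (w : ℂ × ℂ) (z : ℂ) : Prop := Reg z ∧ ∃ p q : ℤ, w = pt z p q

/-- The covering action of `ℤ × ℤ` on `𝓒`. -/
def covAct (v : ℤ × ℤ) (w : ℂ × ℂ) : ℂ × ℂ :=
  (w.1 + v.1 * (Cpi * I), w.2 + v.2 * (Cpi * I))

/-- The subset `V ⊂ (ℤ × ℤ)⁵`. -/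
def Vset : Set (Fin 5 → ℤ × ℤ) :=
  {v | ∃ p₀ p₁ q₀ q₁ q₂ : ℤ,
    v = ![(p₀, q₀), (p₁, q₁), (p₁ - p₀, q₂), (p₁ - p₀ + q₁ - q₀, q₂ - q₁),
          (q₁ - q₀, q₂ - q₁ - p₀)]}

/-- The preimage of `FT` in `𝓒⁵`. -/
def FTpre : Set (Fin 5 → ℂ × ℂ) := {w | ∃ v ∈ FT, ∀ i, LiesOver (w i) (v i)}

/-- A base point `((x₀;0,0),…,(x₄;0,0))` with `(x₀,…,x₄) ∈ FT⁺`. -/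
def basePt : Fin 5 → ℂ × ℂ := fun i => pt (ftTuple ((1 + I) / 4) I i) 0 0

/-- `𝓕𝓣̂₀`: the connected component of the preimage of `FT` in `𝓒⁵` containing the points
`((x₀;0,0),…,(x₄;0,0))` with `(x₀,…,x₄) ∈ FT⁺`. -/
def FThat₀ : Set (Fin 5 → ℂ × ℂ) := connectedComponentIn FTpre basePt

/-- `𝓕𝓣̂ = 𝓕𝓣̂₀ + V`. -/
def FThat : Set (Fin 5 → ℂ × ℂ) :=
  {u | ∃ w ∈ FThat₀, ∃ v ∈ Vset, u = fun i => covAct (v i) (w i)}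

abbrev CoverT : Type := ↥Cover

/-- The generator `(z; p, q)` of the free abelian group on `𝓒`. -/
def genOf (z : ℂ) (h : Reg z) (p q : ℤ) : FreeAbelianGroup CoverT :=
  FreeAbelianGroup.of ⟨pt z p q, pt_mem_Cover h p q⟩

/-- The lifted five term relators. -/
def FiveTermRels : Set (FreeAbelianGroup CoverT) :=
  {a | ∃ w : Fin 5 → ℂ × ℂ, w ∈ FThat ∧ ∃ hc : ∀ i, w i ∈ Cover,
    a = ∑ i : Fin 5, (-1 : ℤ) ^ (i : ℕ) • FreeAbelianGroup.of (⟨w i, hc i⟩ : CoverT)}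

/-- The transfer relators. -/
def TransferRels : Set (FreeAbelianGroup CoverT) :=
  {a | ∃ z : ℂ, ∃ h : Reg z, ∃ p q p' q' : ℤ,
    a = genOf z h p q + genOf z h p' q' - genOf z h p q' - genOf z h p' q}

def relSub : AddSubgroup (FreeAbelianGroup CoverT) :=
  AddSubgroup.closure (FiveTermRels ∪ TransferRels)

def relSub' : AddSubgroup (FreeAbelianGroup CoverT) :=
  AddSubgroup.closure FiveTermRels

/-- The extended pre-Bloch group `êP(ℂ)`. -/
abbrev EPreBloch : Type := FreeAbelianGroup CoverT ⧸ relSub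

/-- The variant `êP'(ℂ)` without the transfer relations. -/
abbrev EPreBloch' : Type := FreeAbelianGroup CoverT ⧸ relSub'

/-- The class `[z, p, q] ∈ êP(ℂ)` (junk value `0` if `z ∈ {0,1}`). -/
def cls (z : ℂ) (p q : ℤ) : EPreBloch :=
  if h : Reg z then QuotientAddGroup.mk (genOf z h p q) else 0

/-- The class `[z, p, q] ∈ êP'(ℂ)` (junk value `0` if `z ∈ {0,1}`). -/
def cls' (z : ℂ) (p q : ℤ) : EPreBloch' :=
  if h : Reg z then QuotientAddGroup.mk (genOf z h p q) else 0

/-- `ℂ ∧_ℤ ℂ`, the second exterior power of `ℂ` as a `ℤ`-module. -/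
abbrev L2C : Type := ↥(⋀[ℤ]^2 ℂ)

/-- The wedge `a ∧ b ∈ ℂ ∧_ℤ ℂ`. -/
def wedge (a b : ℂ) : L2C :=
  ⟨ExteriorAlgebra.ιMulti ℤ 2 ![a, b],
   ExteriorAlgebra.ιMulti_range ℤ 2 (Set.mem_range_self _)⟩

def nuFree : FreeAbelianGroup CoverT →+ L2C :=
  FreeAbelianGroup.lift fun w : CoverT => wedge w.1.1 w.1.2

/-- The homomorphism `ν : êP(ℂ) → ℂ ∧_ℤ ℂ`. -/
def nuHom : EPreBloch →+ L2C :=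
  if h : ∀ a ∈ relSub, nuFree a = 0 then QuotientAddGroup.lift relSub nuFree h else 0

/-- The homomorphism `ν : êP'(ℂ) → ℂ ∧_ℤ ℂ`. -/
def nuHom' : EPreBloch' →+ L2C :=
  if h : ∀ a ∈ relSub', nuFree a = 0 then QuotientAddGroup.lift relSub' nuFree h else 0

/-- The extended Bloch group `êB(ℂ) = ker ν`. -/
def EBloch : AddSubgroup EPreBloch := nuHom.ker

/-- `êB'(ℂ) = ker ν` on `êP'(ℂ)`. -/
def EBloch' : AddSubgroup EPreBloch' := nuHom'.ker

/-- The component `X₀₀` of `𝓒` (both fiber coordinates even). -/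
def X00 : Set (ℂ × ℂ) := {w | ∃ z : ℂ, Reg z ∧ ∃ p q : ℤ, w = pt z (2 * p) (2 * q)}

abbrev X00T : Type := ↥X00

lemma pt_mem_X00 {z : ℂ} (h : Reg z) (p q : ℤ) : pt z (2 * p) (2 * q) ∈ X00 :=
  ⟨z, h, p, q, rfl⟩

/-- The generator `(z; 2p, 2q)` of the free abelian group on `X₀₀`. -/
def genOf₀ (z : ℂ) (h : Reg z) (p q : ℤ) : FreeAbelianGroup X00T :=
  FreeAbelianGroup.of ⟨pt z (2 * p) (2 * q), pt_mem_X00 h p q⟩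

/-- The five term relators coming from `𝓕𝓣̂ ∩ (X₀₀)⁵`. -/
def FiveTermRels₀ : Set (FreeAbelianGroup X00T) :=
  {a | ∃ w : Fin 5 → ℂ × ℂ, w ∈ FThat ∧ ∃ hc : ∀ i, w i ∈ X00,
    a = ∑ i : Fin 5, (-1 : ℤ) ^ (i : ℕ) • FreeAbelianGroup.of (⟨w i, hc i⟩ : X00T)}

def relSub₀ : AddSubgroup (FreeAbelianGroup X00T) := AddSubgroup.closure FiveTermRels₀

/-- The true extended pre-Bloch group `êêP(ℂ)`. -/
abbrev EEPreBloch : Type := FreeAbelianGroup X00T ⧸ relSub₀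

/-- The class `[z, 2p, 2q] ∈ êêP(ℂ)` (junk value `0` if `z ∈ {0,1}`). -/
def cls₀ (z : ℂ) (p q : ℤ) : EEPreBloch :=
  if h : Reg z then QuotientAddGroup.mk (genOf₀ z h p q) else 0

def nuFree₀ : FreeAbelianGroup X00T →+ L2C :=
  FreeAbelianGroup.lift fun w : X00T => wedge w.1.1 w.1.2

/-- The homomorphism `ν̂ : êêP(ℂ) → ℂ ∧_ℤ ℂ`. -/
def nuHom₀ : EEPreBloch →+ L2C :=
  if h : ∀ a ∈ relSub₀, nuFree₀ a = 0 then QuotientAddGroup.lift relSub₀ nuFree₀ h else 0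

/-- The true extended Bloch group `êêB(ℂ) = ker ν̂`. -/
def EEBloch : AddSubgroup EEPreBloch := nuHom₀.ker

/-- The Rogers dilogarithm `𝓡(z) = ½ log z log(1-z) - ∫₀ᶻ log(1-t)/t dt` (straight segment,
parametrized by `t = s z`). -/
def rogers (z : ℂ) : ℂ :=
  (1 / 2) * Complex.log z * Complex.log (1 - z) -
    ∫ s in (0:ℝ)..(1:ℝ), Complex.log (1 - (s : ℂ) * z) / (s : ℂ)

/-- `R(z; p, q) = 𝓡(z) + (πi/2)(p log(1-z) + q log z) - π²/6`. -/
def Rfun (z : ℂ) (p q : ℤ) : ℂ :=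
  rogers z + (Cpi * I / 2) * (p * Complex.log (1 - z) + q * Complex.log z) - Cpi ^ 2 / 6

/-- `R̂(z; 2p, 2q) = 𝓡(z) + πi(p log(1-z) + q log z) - π²/6`. -/
def Rhat (z : ℂ) (p q : ℤ) : ℂ :=
  rogers z + Cpi * I * (p * Complex.log (1 - z) + q * Complex.log z) - Cpi ^ 2 / 6

/-- `ℂ / π²ℤ`. -/
abbrev ModPiSq : Type := ℂ ⧸ AddSubgroup.zmultiples (Cpi ^ 2)

/-- `ℂ / 2π²ℤ`. -/
abbrev Mod2PiSq : Type := ℂ ⧸ AddSubgroup.zmultiples (2 * Cpi ^ 2)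

abbrev RegT : Type := {z : ℂ // Reg z}

def pbGen (z : ℂ) (h : Reg z) : FreeAbelianGroup RegT := FreeAbelianGroup.of ⟨z, h⟩

/-- The five term relators for the classical pre-Bloch group. -/
def pbRels : Set (FreeAbelianGroup RegT) :=
  {a | ∃ x y : ℂ, ∃ hx : Reg x, ∃ hy : Reg y, x ≠ y ∧
    ∃ h2 : Reg (y / x), ∃ h3 : Reg ((1 - x⁻¹) / (1 - y⁻¹)), ∃ h4 : Reg ((1 - x) / (1 - y)),
    a = pbGen x hx - pbGen y hy + pbGen (y / x) h2 -
        pbGen ((1 - x⁻¹) / (1 - y⁻¹)) h3 + pbGen ((1 - x) / (1 - y)) h4}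

def pbSub : AddSubgroup (FreeAbelianGroup RegT) := AddSubgroup.closure pbRels

/-- The classical pre-Bloch group `P(ℂ)`. -/
abbrev PreBloch : Type := FreeAbelianGroup RegT ⧸ pbSub

/-- The class `[z] ∈ P(ℂ)` (junk value `0` if `z ∈ {0,1}`). -/
def pbCls (z : ℂ) : PreBloch :=
  if h : Reg z then QuotientAddGroup.mk (pbGen z h) else 0

/-- `ℂ* ∧_ℤ ℂ*`, the second exterior power of the multiplicative group `ℂ*` as `ℤ`-module. -/
abbrev L2CU : Type := ↥(⋀[ℤ]^2 (Additive ℂˣ))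

/-- The wedge `a ∧ b ∈ ℂ* ∧_ℤ ℂ*`. -/
def wedgeU (a b : ℂˣ) : L2CU :=
  ⟨ExteriorAlgebra.ιMulti ℤ 2 ![Additive.ofMul a, Additive.ofMul b],
   ExteriorAlgebra.ιMulti_range ℤ 2 (Set.mem_range_self _)⟩

def nuPBFree : FreeAbelianGroup RegT →+ L2CU :=
  FreeAbelianGroup.lift fun z : RegT =>
    2 • wedgeU (Units.mk0 z.1 z.2.1) (Units.mk0 (1 - z.1) (sub_ne_zero_of_ne (Ne.symm z.2.2)))

/-- The homomorphism `P(ℂ) → ℂ* ∧_ℤ ℂ*`, `[z] ↦ 2 (z ∧ (1-z))`. -/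
def nuPB : PreBloch →+ L2CU :=
  if h : ∀ a ∈ pbSub, nuPBFree a = 0 then QuotientAddGroup.lift pbSub nuPBFree h else 0

/-- The classical Bloch group `B(ℂ)`. -/
def Bloch : AddSubgroup PreBloch := nuPB.ker

/-- The roots of unity in `ℂ*`. -/
def muStar : Set ℂˣ := {ζ | ∃ n : ℕ, 0 < n ∧ ζ ^ n = 1}

abbrev SL2C := Matrix.SpecialLinearGroup (Fin 2) ℂ

/-- `PSL(2,ℂ) = SL(2,ℂ)/{±1}` as a discrete group. -/
abbrev PSL2C := SL2C ⧸ Subgroup.center SL2C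

/-- The boundary map `C₃ → C₂` of the inhomogeneous bar complex computing `H₃(PSL(2,ℂ);ℤ)`. -/
def d3 : FreeAbelianGroup (Fin 3 → PSL2C) →+ FreeAbelianGroup (Fin 2 → PSL2C) :=
  FreeAbelianGroup.lift fun g =>
    FreeAbelianGroup.of ![g 1, g 2] - FreeAbelianGroup.of ![g 0 * g 1, g 2] +
      FreeAbelianGroup.of ![g 0, g 1 * g 2] - FreeAbelianGroup.of ![g 0, g 1]

/-- The boundary map `C₄ → C₃` of the inhomogeneous bar complex computing `H₃(PSL(2,ℂ);ℤ)`. -/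
def d4 : FreeAbelianGroup (Fin 4 → PSL2C) →+ FreeAbelianGroup (Fin 3 → PSL2C) :=
  FreeAbelianGroup.lift fun g =>
    FreeAbelianGroup.of ![g 1, g 2, g 3] - FreeAbelianGroup.of ![g 0 * g 1, g 2, g 3] +
      FreeAbelianGroup.of ![g 0, g 1 * g 2, g 3] - FreeAbelianGroup.of ![g 0, g 1, g 2 * g 3] +
      FreeAbelianGroup.of ![g 0, g 1, g 2]

/-- `H₃(PSL(2,ℂ);ℤ)`, defined as homology of the inhomogeneous bar complex. -/
abbrev H3PSL2C : Type := ↥d3.ker ⧸ ((d4.range).addSubgroupOf d3.ker)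

/-- The set of combinatorial flattenings. -/
def Flattenings : Set (ℂ × ℂ × ℂ) :=
  {w | w.1 + w.2.1 + w.2.2 = 0 ∧ ∃ z : ℂ, Reg z ∧ ∃ p q r : ℤ,
    w.1 = Complex.log z + p * (Cpi * I) ∧
    w.2.1 = -Complex.log (1 - z) + q * (Cpi * I) ∧
    w.2.2 = Complex.log (1 - z) - Complex.log z + r * (Cpi * I)}

/-- The map `ℓ : 𝓒 → ℂ³`. -/
def ellMap (w : ℂ × ℂ) : ℂ × ℂ × ℂ := (w.1, w.2, -w.1 - w.2)

/-- The element `κ = [x,1,1] + [x,0,0] - [x,1,0] - [x,0,1] ∈ êP'(ℂ)`. -/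
def kap (x : ℂ) : EPreBloch' := cls' x 1 1 + cls' x 0 0 - cls' x 1 0 - cls' x 0 1

/-- The natural projection `êP'(ℂ) → êP(ℂ)`. -/
def projP : EPreBloch' →+ EPreBloch :=
  QuotientAddGroup.map relSub' relSub (AddMonoidHom.id _)
    (by
      rw [AddSubgroup.comap_id]
      exact AddSubgroup.closure_mono Set.subset_union_left)

open Filter Topology

lemma const_of_locally_const {X Y : Type*} [TopologicalSpace X] {S : Set X}
    (hS : IsPreconnected S) {f : X → Y} (h : ∀ x ∈ S, ∀ᶠ y in 𝓝[S] x, f y = f x)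
    {x y : X} (hx : x ∈ S) (hy : y ∈ S) : f x = f y :=
  hS.induction₂ (fun a b => f a = f b) (fun a ha => (h a ha).mono fun _ hb => hb.symm)
    (fun _ _ _ _ _ _ => Eq.trans) (fun _ _ _ _ => Eq.symm) hx hy

/-- The dilogarithm `Li₂`, as an integral along a straight segment. -/
def dilog (z : ℂ) : ℂ := -∫ s in (0:ℝ)..(1:ℝ), Complex.log (1 - (s : ℂ) * z) / (s : ℂ)

lemma one_sub_mul_mem_slitPlane {z : ℂ} (hz : 1 - z ∈ slitPlane) {s : ℝ} (h0 : 0 ≤ s)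
    (h1 : s ≤ 1) : 1 - (s : ℂ) * z ∈ slitPlane := by
  have := StarConvex.add_smul_mem (y := -z) starConvex_one_slitPlane
    (by rwa [← sub_eq_add_neg]) h0 h1
  rwa [real_smul, mul_neg, ← sub_eq_add_neg] at this

lemma intervalIntegrable_div_ofReal {f : ℝ → ℂ} {b : ℝ} (hb : 0 ≤ b) (h0 : f 0 = 0)
    (hf : ContinuousOn f (Set.Icc 0 b)) (hd : DifferentiableAt ℝ f 0) :
    IntervalIntegrable (fun s : ℝ => f s / (s : ℂ)) MeasureTheory.volume 0 b := by
  have hc : IntervalIntegrable (dslope f 0) MeasureTheory.volume 0 b := by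
    refine ContinuousOn.intervalIntegrable_of_Icc hb fun s hs => ?_
    rcases eq_or_ne s 0 with rfl | h
    · exact (continuousAt_dslope_same.2 hd).continuousWithinAt
    · exact (continuousWithinAt_dslope_of_ne h).2 (hf s hs)
  refine hc.congr fun s hs => ?_
  rw [Set.uIoc_of_le hb] at hs
  rw [dslope_of_ne _ hs.1.ne', slope_def_module, h0, sub_zero, sub_zero, real_smul, ofReal_inv,
    div_eq_inv_mul]

lemma intervalIntegrable_log_div {z : ℂ} (hz : 1 - z ∈ slitPlane) :
    IntervalIntegrable (fun s : ℝ => Complex.log (1 - (s : ℂ) * z) / (s : ℂ))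
      MeasureTheory.volume 0 1 := by
  have hd : ∀ s ∈ Set.Icc (0:ℝ) 1,
      DifferentiableAt ℝ (fun s : ℝ => Complex.log (1 - (s : ℂ) * z)) s := fun s hs =>
    have h : DifferentiableAt ℝ (fun s : ℝ => 1 - (s : ℂ) * z) s :=
      ((ofRealCLM.differentiableAt).mul_const z).const_sub 1
    (h.hasDerivAt.clog_real (one_sub_mul_mem_slitPlane hz hs.1 hs.2)).differentiableAt
  exact intervalIntegrable_div_ofReal zero_le_one (by simp)
    (fun s hs => (hd s hs).continuousAt.continuousWithinAt) (hd 0 (by simp))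

lemma hasDerivAt_dilog_integral {z : ℂ} (hz : 1 - z ∈ slitPlane) :
    HasDerivAt dilog (∫ s in (0:ℝ)..1, (1 - (s : ℂ) * z)⁻¹) z := by
  obtain ⟨r, hr, hball⟩ : ∃ r > 0, Metric.closedBall z r ⊆ {w : ℂ | 1 - w ∈ slitPlane} := by
    refine Metric.nhds_basis_closedBall.mem_iff.1 ?_
    exact (isOpen_slitPlane.preimage (by fun_prop : Continuous fun w : ℂ => 1 - w)).mem_nhds hz
  have hcont : ContinuousOn (fun q : ℂ × ℝ => (1 - (q.2 : ℂ) * q.1)⁻¹)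
      (Metric.closedBall z r ×ˢ Set.Icc (0:ℝ) 1) := by
    refine ContinuousOn.inv₀ (by fun_prop) fun q hq => ?_
    exact slitPlane_ne_zero (one_sub_mul_mem_slitPlane (hball hq.1) hq.2.1 hq.2.2)
  obtain ⟨C, hC⟩ := ((isCompact_closedBall z r).prod isCompact_Icc).exists_bound_of_continuousOn
    hcont
  have key := intervalIntegral.hasDerivAt_integral_of_dominated_loc_of_deriv_le
    (μ := MeasureTheory.volume) (a := 0) (b := 1) (bound := fun _ => C)
    (F := fun (w : ℂ) (s : ℝ) => Complex.log (1 - (s : ℂ) * w) / (s : ℂ))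
    (F' := fun (w : ℂ) (s : ℝ) => -(1 - (s : ℂ) * w)⁻¹) (x₀ := z)
    (s := Metric.closedBall z r) (Metric.closedBall_mem_nhds z hr)
    (Filter.Eventually.of_forall fun w => by
      apply Measurable.aestronglyMeasurable
      fun_prop)
    (intervalIntegrable_log_div hz)
    (by apply Measurable.aestronglyMeasurable; fun_prop)
    (Filter.Eventually.of_forall fun s hs w hw => by
      rw [Set.uIoc_of_le zero_le_one] at hs
      rw [norm_neg]
      exact hC (w, s) ⟨hw, hs.1.le, hs.2⟩)
    (by simp)
    (Filter.Eventually.of_forall fun s hs w hw => by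
      rw [Set.uIoc_of_le zero_le_one] at hs
      have hm := one_sub_mul_mem_slitPlane (hball hw) hs.1.le hs.2
      have hs0 : (s : ℂ) ≠ 0 := by exact_mod_cast hs.1.ne'
      have := (((hasDerivAt_id w).const_mul (s : ℂ)).const_sub 1).clog hm
      convert! this.div_const (s : ℂ) using 1
      have := slitPlane_ne_zero hm
      simp only [id] at *
      field_simp)
  have := key.2.neg
  rwa [intervalIntegral.integral_neg, neg_neg] at this

lemma hasDerivAt_dilog {z : ℂ} (h0 : z ≠ 0) (hz : 1 - z ∈ slitPlane) :
    HasDerivAt dilog (-Complex.log (1 - z) / z) z := by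
  have hval : (∫ s in (0:ℝ)..1, (1 - (s : ℂ) * z)⁻¹) = -Complex.log (1 - z) / z := by
    have := log_inv_eq_integral hz
    rw [log_inv _ (slitPlane_arg_ne_pi hz)] at this
    rw [this, mul_div_cancel_left₀ _ h0]
    simp only [real_smul]
  exact hval ▸ hasDerivAt_dilog_integral hz

lemma continuousAt_dilog {z : ℂ} (hz : 1 - z ∈ slitPlane) : ContinuousAt dilog z :=
  (hasDerivAt_dilog_integral hz).continuousAt

lemma dilog_zero : dilog 0 = 0 := by simp [dilog]

lemma tendsto_log_mul_log_zero :
    Tendsto (fun z : ℂ => Complex.log z * Complex.log (1 - z)) (𝓝 0) (𝓝 0) := by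
  have hlim : Tendsto (fun z : ℂ => 3 / 2 * (‖‖z‖ * Real.log ‖z‖‖ + Real.pi * ‖z‖)) (𝓝 0)
      (𝓝 0) := by
    have : Continuous fun z : ℂ => 3 / 2 * (‖‖z‖ * Real.log ‖z‖‖ + Real.pi * ‖z‖) := by
      have := Real.continuous_mul_log.comp (continuous_norm (E := ℂ))
      simp only [Function.comp_def] at this
      fun_prop
    simpa using this.tendsto 0
  refine squeeze_zero_norm' ?_ hlim
  filter_upwards [Metric.closedBall_mem_nhds (0:ℂ) (by norm_num : (0:ℝ) < 1 / 2)] with z hz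
  rw [mem_closedBall_zero_iff] at hz
  have h1 : ‖Complex.log (1 - z)‖ ≤ 3 / 2 * ‖z‖ := by
    have := norm_log_one_add_half_le_self (z := -z) (by rwa [norm_neg])
    rwa [norm_neg, ← sub_eq_add_neg] at this
  have h2 : ‖Complex.log z‖ ≤ |Real.log ‖z‖| + Real.pi := by
    refine (norm_le_abs_re_add_abs_im _).trans ?_
    rw [log_re, log_im]
    gcongr
    exact abs_arg_le_pi z
  calc ‖Complex.log z * Complex.log (1 - z)‖
      ≤ (|Real.log ‖z‖| + Real.pi) * (3 / 2 * ‖z‖) := by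
        rw [norm_mul]
        gcongr
    _ = _ := by
        rw [norm_mul, norm_norm, Real.norm_eq_abs]
        ring

lemma tendsto_log_mul_log_one :
    Tendsto (fun z : ℂ => Complex.log z * Complex.log (1 - z)) (𝓝 1) (𝓝 0) := by
  have h : Tendsto (fun z : ℂ => 1 - z) (𝓝 1) (𝓝 0) := by
    have hc : Continuous fun z : ℂ => 1 - z := by fun_prop
    simpa using hc.tendsto 1
  refine (tendsto_log_mul_log_zero.comp h).congr fun z => ?_
  simp [mul_comm]

lemma dilog_one : dilog 1 = (Real.pi : ℂ) ^ 2 / 6 := by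
  have hint : ∀ n : ℕ, ∫ s in (0:ℝ)..1, s ^ n / ((n : ℝ) + 1) = 1 / ((n : ℝ) + 1) ^ 2 := by
    intro n
    rw [intervalIntegral.integral_div, integral_pow]
    field_simp
    simp
  have hsum : HasSum (fun n : ℕ => 1 / ((n : ℝ) + 1) ^ 2) (Real.pi ^ 2 / 6) := by
    have := (hasSum_nat_add_iff' 1).2 hasSum_zeta_two
    simpa using this
  have key := MeasureTheory.hasSum_integral_of_summable_integral_norm
    (μ := MeasureTheory.volume.restrict (Set.Ioc (0:ℝ) 1))
    (F := fun (n : ℕ) (s : ℝ) => s ^ n / ((n : ℝ) + 1))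
    (fun n => by
      rw [← MeasureTheory.IntegrableOn,
        ← intervalIntegrable_iff_integrableOn_Ioc_of_le zero_le_one]
      exact Continuous.intervalIntegrable (by fun_prop) _ _)
    (by
      refine hsum.summable.congr fun n => ?_
      rw [← hint, intervalIntegral.integral_of_le zero_le_one]
      refine (MeasureTheory.setIntegral_congr_fun measurableSet_Ioc fun s hs => ?_)
      have := hs.1.le
      simp only [Real.norm_eq_abs]
      exact (abs_of_nonneg (by positivity)).symm)
  simp only [← intervalIntegral.integral_of_le zero_le_one, hint] at key
  have hval := key.unique hsum
  rw [dilog, ← intervalIntegral.integral_neg]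
  have : (Real.pi : ℂ) ^ 2 / 6 = ((Real.pi ^ 2 / 6 : ℝ) : ℂ) := by push_cast; rfl
  rw [this, ← hval, ← intervalIntegral.integral_ofReal]
  refine intervalIntegral.integral_congr_ae ?_
  have hne : ∀ᵐ s : ℝ, s ≠ 1 := by simp [MeasureTheory.ae_iff]
  filter_upwards [hne] with s h1 hs
  rw [Set.uIoc_of_le zero_le_one] at hs
  have hs1 : s < 1 := lt_of_le_of_ne hs.2 h1
  have hser := (Real.hasSum_pow_div_log_of_abs_lt_one
    (abs_lt.2 ⟨by linarith [hs.1], hs1⟩)).div_const s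
  have heq : (fun n : ℕ => s ^ (n + 1) / ((n : ℝ) + 1) / s) = fun n : ℕ => s ^ n / ((n : ℝ) + 1) := by
    funext n
    have := hs.1.ne'
    rw [pow_succ]
    field_simp
  rw [heq] at hser
  rw [hser.tsum_eq, mul_one]
  have : (1 : ℂ) - s = ((1 - s : ℝ) : ℂ) := by push_cast; rfl
  rw [this, ← ofReal_log (by linarith)]
  push_cast
  ring

lemma hasDerivAt_euler_sum {z : ℂ} (hz : z ∈ slitPlane) (hz' : 1 - z ∈ slitPlane) :
    HasDerivAt (fun z => dilog z + dilog (1 - z) + Complex.log z * Complex.log (1 - z)) 0 z := by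
  have h0 := slitPlane_ne_zero hz
  have h1 := slitPlane_ne_zero hz'
  have hs : HasDerivAt (fun z : ℂ => 1 - z) (-1) z := (hasDerivAt_id z).const_sub 1
  have hd : HasDerivAt (fun z => dilog (1 - z)) _ z :=
    (hasDerivAt_dilog h1 (by simpa using hz)).comp z hs
  convert! ((hasDerivAt_dilog h0 hz').add hd).add ((hasDerivAt_log hz).mul (hs.clog hz')) using 1
  simp only [sub_sub_cancel]
  field_simp
  ring

lemma intervalIntegrable_log_one_sub (a b : ℝ) :
    IntervalIntegrable (fun s : ℝ => Complex.log (1 - (s : ℂ))) MeasureTheory.volume a b := by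
  have h1 : IntervalIntegrable (fun s : ℝ => Real.log (1 - s)) MeasureTheory.volume a b := by
    simpa using (intervalIntegral.intervalIntegrable_log' (a := 1 - a) (b := 1 - b)).comp_sub_left 1
  have h2 : IntervalIntegrable (fun s : ℝ => |Real.log (1 - s)| + Real.pi)
      MeasureTheory.volume a b := h1.abs.add intervalIntegrable_const
  refine h2.mono_fun' (Measurable.aestronglyMeasurable (by fun_prop))
    (Filter.Eventually.of_forall fun s => ?_)
  refine (norm_le_abs_re_add_abs_im _).trans ?_
  have : (1 : ℂ) - s = ((1 - s : ℝ) : ℂ) := by push_cast; rfl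
  rw [log_re, log_im, this, norm_real, Real.norm_eq_abs, Real.log_abs]
  exact add_le_add_right (abs_arg_le_pi _) _

lemma intervalIntegrable_log_one_sub_div {b : ℝ} (hb : 0 ≤ b) :
    IntervalIntegrable (fun s : ℝ => Complex.log (1 - (s : ℂ)) / (s : ℂ))
      MeasureTheory.volume 0 b := by
  have h1 : IntervalIntegrable (fun s : ℝ => Complex.log (1 - (s : ℂ)) / (s : ℂ))
      MeasureTheory.volume 0 (1 / 2) := by
    have hd : ∀ s ∈ Set.Icc (0:ℝ) (1 / 2),
        DifferentiableAt ℝ (fun s : ℝ => Complex.log (1 - (s : ℂ))) s := fun s hs => by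
      have h : DifferentiableAt ℝ (fun s : ℝ => 1 - (s : ℂ)) s :=
        ofRealCLM.differentiableAt.const_sub 1
      refine (h.hasDerivAt.clog_real (Or.inl ?_)).differentiableAt
      have := hs.2
      simp only [sub_re, one_re, ofReal_re]
      linarith
    exact intervalIntegrable_div_ofReal (by norm_num) (by simp)
      (fun s hs => (hd s hs).continuousAt.continuousWithinAt) (hd 0 (by simp))
  have h2 : ∀ c : ℝ, 1 / 2 ≤ c → IntervalIntegrable
      (fun s : ℝ => Complex.log (1 - (s : ℂ)) / (s : ℂ)) MeasureTheory.volume (1 / 2) c := by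
    intro c hc
    simp only [div_eq_mul_inv]
    refine (intervalIntegrable_log_one_sub _ _).mul_continuousOn
      (ContinuousOn.inv₀ (by fun_prop) fun s hs => ?_)
    rw [Set.uIcc_of_le (by simpa using hc)] at hs
    have : (0:ℝ) < s := lt_of_lt_of_le (by norm_num) hs.1
    exact_mod_cast this.ne'
  refine (h1.trans (h2 (b + 1 / 2) (by linarith))).mono_set ?_
  rw [Set.uIcc_of_le hb, Set.uIcc_of_le (by linarith)]
  exact Set.Icc_subset_Icc_right (by linarith)

lemma dilog_ofReal (t : ℝ) :
    dilog t = -∫ s in (0:ℝ)..t, Complex.log (1 - (s : ℂ)) / (s : ℂ) := by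
  rcases eq_or_ne t 0 with rfl | ht
  · simp [dilog]
  have := intervalIntegral.smul_integral_comp_mul_right (a := 0) (b := 1)
    (fun s : ℝ => Complex.log (1 - (s : ℂ)) / (s : ℂ)) t
  rw [zero_mul, one_mul, ← intervalIntegral.integral_smul] at this
  rw [dilog, ← this]
  congr 2
  funext s
  have : (t : ℂ) ≠ 0 := by exact_mod_cast ht
  simp only [ofReal_mul, real_smul]
  rcases eq_or_ne (s : ℂ) 0 with hs | hs
  · simp [hs]
  · field_simp

lemma tendsto_dilog_ofReal_one :
    Tendsto (fun t : ℝ => dilog t) (𝓝 1) (𝓝 ((Real.pi : ℂ) ^ 2 / 6)) := by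
  rw [← dilog_one]
  simp only [dilog_ofReal]
  have h := intervalIntegral.continuousOn_primitive_interval'
    (intervalIntegrable_log_one_sub_div (b := 2) (by norm_num)) Set.left_mem_uIcc
  have h1 := (h.continuousAt (x := 1) (by
    rw [Set.uIcc_of_le (by norm_num)]
    exact Icc_mem_nhds (by norm_num) (by norm_num))).neg
  have hv : dilog 1 = -∫ x in (0:ℝ)..1, Complex.log (1 - (x : ℂ)) / (x : ℂ) := by
    simpa using dilog_ofReal 1
  rw [hv]
  exact h1.tendsto

lemma tendsto_euler_sum_ofReal_one :
    Tendsto (fun t : ℝ => dilog t + dilog (1 - t) + Complex.log t * Complex.log (1 - t))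
      (𝓝 1) (𝓝 ((Real.pi : ℂ) ^ 2 / 6)) := by
  have hc : Tendsto (fun t : ℝ => (t : ℂ)) (𝓝 1) (𝓝 1) := by
    simpa using continuous_ofReal.tendsto 1
  have h1 : Tendsto (fun t : ℝ => dilog (1 - t)) (𝓝 1) (𝓝 0) := by
    have := (continuousAt_dilog (z := 0) (by simp)).tendsto
    rw [dilog_zero] at this
    refine this.comp ?_
    simpa using hc.const_sub 1
  simpa using (tendsto_dilog_ofReal_one.add h1).add (tendsto_log_mul_log_one.comp hc)

lemma isPreconnected_doubly_slit :
    IsPreconnected {z : ℂ | z ∈ slitPlane ∧ 1 - z ∈ slitPlane} := by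
  have h := starConvex_ofReal_slitPlane (x := 1 / 2) (by norm_num)
  have hstar : StarConvex ℝ ((1 / 2 : ℝ) : ℂ) {z : ℂ | z ∈ slitPlane ∧ 1 - z ∈ slitPlane} := by
    intro z hz a b ha hb hab
    refine ⟨h hz.1 ha hb hab, ?_⟩
    have := h hz.2 ha hb hab
    convert! this using 1
    have : (a : ℂ) + b = 1 := by exact_mod_cast hab
    simp only [real_smul]
    push_cast
    linear_combination (-1 : ℂ) * this
  refine (hstar.isPathConnected ⟨Or.inl ?_, Or.inl ?_⟩).isConnected.isPreconnected
  · norm_num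
  · norm_num

lemma dilog_reflection_of_slit {z : ℂ} (hz : z ∈ slitPlane) (hz' : 1 - z ∈ slitPlane) :
    dilog z + dilog (1 - z) + Complex.log z * Complex.log (1 - z) = (Real.pi : ℂ) ^ 2 / 6 := by
  have hopen : IsOpen {z : ℂ | z ∈ slitPlane ∧ 1 - z ∈ slitPlane} :=
    isOpen_slitPlane.inter
      (isOpen_slitPlane.preimage (by fun_prop : Continuous fun w : ℂ => 1 - w))
  refine tendsto_nhds_unique (tendsto_const_nhds.congr' ?_)
    (tendsto_euler_sum_ofReal_one.mono_left (nhdsWithin_le_nhds (s := Set.Iio 1)))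
  filter_upwards [Ioo_mem_nhdsLT (zero_lt_one' ℝ)] with t ht
  refine hopen.is_const_of_deriv_eq_zero isPreconnected_doubly_slit
    (fun w hw => (hasDerivAt_euler_sum hw.1 hw.2).differentiableAt.differentiableWithinAt)
    (fun w hw => (hasDerivAt_euler_sum hw.1 hw.2).deriv) ⟨hz, hz'⟩ ⟨Or.inl ?_, Or.inl ?_⟩
  · simpa using ht.1
  · simpa using ht.2

lemma hasDerivAt_euler_sum_ofReal {t : ℝ} (ht : 1 < t) :
    HasDerivAt (fun t : ℝ => dilog t + dilog (1 - t) + Complex.log t * Complex.log (1 - t)) 0 t := by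
  have hlog : (fun s : ℝ => Complex.log (1 - (s : ℂ))) =ᶠ[𝓝 t]
      fun s : ℝ => Complex.log ((s : ℂ) - 1) + Real.pi * I := by
    filter_upwards [lt_mem_nhds ht] with s hs
    have h1 : (1 : ℂ) - s = -((s - 1 : ℝ) : ℂ) := by push_cast; ring
    have h2 : (s : ℂ) - 1 = ((s - 1 : ℝ) : ℂ) := by push_cast; ring
    have h3 : 0 < s - 1 := by linarith
    rw [h1, h2, ← ofReal_neg, Complex.log, Complex.log, arg_ofReal_of_neg (by linarith),
      arg_ofReal_of_nonneg h3.le, ofReal_neg, norm_neg]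
    simp
  have hsub : HasDerivAt (fun s : ℝ => (s : ℂ) - 1) 1 t := (ofRealCLM.hasDerivAt).sub_const 1
  have hm : (t : ℂ) - 1 ∈ slitPlane := Or.inl (by simpa using ht)
  have hm' : (t : ℂ) ∈ slitPlane := Or.inl (by simpa using zero_lt_one.trans ht)
  have hl : HasDerivAt (fun s : ℝ => Complex.log (1 - (s : ℂ))) (1 / ((t : ℂ) - 1)) t :=
    ((hsub.clog_real hm).add_const _).congr_of_eventuallyEq hlog
  have h0 : (t : ℂ) ≠ 0 := slitPlane_ne_zero hm'
  have h1 : (t : ℂ) - 1 ≠ 0 := slitPlane_ne_zero hm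
  have hd1 : HasDerivAt (fun s : ℝ => dilog s) (-(Complex.log (1 - t) / t)) t := by
    simp only [dilog_ofReal]
    refine (intervalIntegral.integral_hasDerivAt_right
      (intervalIntegrable_log_one_sub_div (by linarith)) ?_ ?_).neg
    · refine Measurable.stronglyMeasurable ?_ |>.stronglyMeasurableAtFilter
      fun_prop
    · exact hl.continuousAt.div continuous_ofReal.continuousAt h0
  have hs : HasDerivAt (fun z : ℂ => 1 - z) (-1) (t : ℂ) := (hasDerivAt_id _).const_sub 1
  have hd2 : HasDerivAt (fun s : ℝ => dilog (1 - s)) _ t :=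
    ((hasDerivAt_dilog (z := 1 - (t : ℂ)) (by rw [← neg_sub]; exact neg_ne_zero.2 h1)
      (by simpa using hm')).comp (t : ℂ) hs).comp_ofReal
  have hd3 : HasDerivAt (fun s : ℝ => Complex.log s) ((t : ℂ)⁻¹) t :=
    (hasDerivAt_log hm').comp_ofReal
  convert! (hd1.add hd2).add (hd3.mul hl) using 1
  have h2 : 1 - (t : ℂ) ≠ 0 := by rw [← neg_sub]; exact neg_ne_zero.2 h1
  simp only [sub_sub_cancel]
  field_simp
  ring

lemma dilog_reflection_of_one_lt {t : ℝ} (ht : 1 < t) :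
    dilog t + dilog (1 - t) + Complex.log t * Complex.log (1 - t) = (Real.pi : ℂ) ^ 2 / 6 := by
  refine tendsto_nhds_unique (tendsto_const_nhds.congr' ?_)
    (tendsto_euler_sum_ofReal_one.mono_left (nhdsWithin_le_nhds (s := Set.Ioi 1)))
  filter_upwards [self_mem_nhdsWithin] with s hs
  exact isOpen_Ioi.is_const_of_deriv_eq_zero (convex_Ioi (1:ℝ)).isPreconnected
    (fun w hw => (hasDerivAt_euler_sum_ofReal hw).differentiableAt.differentiableWithinAt)
    (fun w hw => (hasDerivAt_euler_sum_ofReal hw).deriv) ht hs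

/-- Euler's reflection formula for the dilogarithm. -/
lemma dilog_reflection {z : ℂ} (hz : z ∈ slitPlane) (h1 : z ≠ 1) :
    dilog z + dilog (1 - z) + Complex.log z * Complex.log (1 - z) = (Real.pi : ℂ) ^ 2 / 6 := by
  by_cases hz' : 1 - z ∈ slitPlane
  · exact dilog_reflection_of_slit hz hz'
  · rw [mem_slitPlane_iff, not_or] at hz'
    simp only [sub_re, one_re, sub_im, one_im, not_lt, zero_sub, neg_ne_zero, not_not] at hz'
    have hzr : (z.re : ℂ) = z := Complex.ext rfl hz'.2.symm
    rw [← hzr]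
    refine dilog_reflection_of_one_lt (lt_of_le_of_ne (by linarith [hz'.1]) fun h => h1 ?_)
    rw [← hzr, ← h, ofReal_one]

lemma mem_X00_iff {w : ℂ × ℂ} : w ∈ X00 ↔ Complex.exp w.1 + Complex.exp (-w.2) = 1 := by
  constructor
  · rintro ⟨z, hz, p, q, rfl⟩
    have h1 : Complex.exp (Complex.log z + ((2 * p : ℤ) : ℂ) * (Cpi * I)) = z := by
      rw [Complex.exp_add, exp_log hz.1, Complex.exp_eq_one_iff.2 ⟨p, by simp [Cpi]; ring⟩, mul_one]
    have h2 : Complex.exp (-(-Complex.log (1 - z) + ((2 * q : ℤ) : ℂ) * (Cpi * I))) = 1 - z := by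
      rw [neg_add, neg_neg, Complex.exp_add, exp_log (sub_ne_zero.2 hz.2.symm),
        Complex.exp_eq_one_iff.2 ⟨-q, by simp [Cpi]; ring⟩, mul_one]
    simp only [pt]
    rw [h1, h2, add_sub_cancel]
  · intro h
    have h2 : 1 - Complex.exp w.1 = Complex.exp (-w.2) := by rw [← h, add_sub_cancel_left]
    refine ⟨Complex.exp w.1, ⟨Complex.exp_ne_zero _, fun h1 => ?_⟩, ?_⟩
    · rw [h1, sub_self] at h2
      exact Complex.exp_ne_zero _ h2.symm
    · obtain ⟨p, hp⟩ := Complex.exp_eq_exp_iff_exists_int.1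
        (exp_log (Complex.exp_ne_zero w.1)).symm
      obtain ⟨q, hq⟩ := Complex.exp_eq_exp_iff_exists_int.1
        (exp_log (Complex.exp_ne_zero (-w.2))).symm
      refine ⟨p, -q, Prod.ext ?_ ?_⟩
      · simp only [pt, Cpi]
        push_cast
        linear_combination hp
      · simp only [pt, Cpi, h2]
        push_cast
        linear_combination -hq

/-- A lift of `R̂` to `ℂ`, holomorphic where `e^u ∉ [1, ∞)`. -/
def chartZero (u v : ℂ) : ℂ :=
  dilog (Complex.exp u) + u * v / 2 + u * Complex.log (1 - Complex.exp u) - Cpi ^ 2 / 6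

/-- A lift of `R̂` to `ℂ`, holomorphic where `e^u ∉ (-∞, 0]`. -/
def chartOne (u v : ℂ) : ℂ :=
  -dilog (1 - Complex.exp u) - u * v / 2 + v * Complex.log (Complex.exp u)

/-- `R̂` as a function of the two branch values. -/
def RhatMod (u v : ℂ) : Mod2PiSq := QuotientAddGroup.mk (chartZero u v)

lemma mk_eq_mk_of_sub {a b : ℂ} (n : ℤ) (h : a - b = n * (2 * Cpi ^ 2)) :
    (QuotientAddGroup.mk a : Mod2PiSq) = QuotientAddGroup.mk b := by
  rw [QuotientAddGroup.eq_iff_sub_mem, h]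
  exact AddSubgroup.mem_zmultiples_iff.2 ⟨n, by simp⟩

lemma exists_log_eq (w : ℂ) : ∃ n : ℤ, Complex.log (Complex.exp w) = w + n * (2 * Cpi * I) := by
  obtain ⟨n, hn⟩ := Complex.exp_eq_exp_iff_exists_int.1 (exp_log (Complex.exp_ne_zero w))
  exact ⟨n, by rw [hn, Cpi]⟩

lemma one_sub_exp_eq {u v : ℂ} (h : Complex.exp u + Complex.exp (-v) = 1) :
    1 - Complex.exp u = Complex.exp (-v) := by
  rw [← h, add_sub_cancel_left]

lemma RhatMod_eq_chartOne {u v : ℂ} (h : Complex.exp u + Complex.exp (-v) = 1)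
    (hs : Complex.exp u ∈ slitPlane) : RhatMod u v = QuotientAddGroup.mk (chartOne u v) := by
  have hv := one_sub_exp_eq h
  have h1 : Complex.exp u ≠ 1 := fun h1 => Complex.exp_ne_zero (-v) (by rw [← hv, h1, sub_self])
  obtain ⟨p, hp⟩ := exists_log_eq u
  obtain ⟨q, hq⟩ := exists_log_eq (-v)
  have hr := dilog_reflection hs h1
  refine mk_eq_mk_of_sub (2 * (p * q)) ?_
  rw [chartZero, chartOne]
  rw [hv] at hr ⊢
  rw [hp, hq] at *
  push_cast
  simp only [Cpi] at *
  linear_combination hr - 4 * (p : ℂ) * q * (Real.pi : ℂ) ^ 2 * I_sq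

lemma RhatMod_pt (z : ℂ) (h : Reg z) (p q : ℤ) :
    RhatMod (pt z (2 * p) (2 * q)).1 (pt z (2 * p) (2 * q)).2 =
      QuotientAddGroup.mk (Rhat z p q) := by
  have h1 : Complex.exp (Complex.log z + ((2 * p : ℤ) : ℂ) * (Cpi * I)) = z := by
    rw [Complex.exp_add, exp_log h.1, Complex.exp_eq_one_iff.2 ⟨p, by simp [Cpi]; ring⟩, mul_one]
  have h2 : rogers z = Complex.log z * Complex.log (1 - z) / 2 + dilog z := by
    rw [rogers, dilog]
    ring
  refine mk_eq_mk_of_sub (-(p * q)) ?_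
  rw [Rhat, chartZero, h2]
  simp only [pt]
  rw [h1]
  push_cast
  linear_combination 2 * (p : ℂ) * q * Cpi ^ 2 * I_sq

lemma RhatMod_add {u v : ℂ} (h : Complex.exp u + Complex.exp (-v) = 1) (a b : ℤ) :
    RhatMod (u + 2 * a * (Cpi * I)) (v + 2 * b * (Cpi * I)) =
      RhatMod u v + QuotientAddGroup.mk (Cpi * I * (b * u - a * v)) := by
  have h1 : Complex.exp (u + 2 * a * (Cpi * I)) = Complex.exp u := by
    have : Complex.exp (2 * a * (Cpi * I)) = 1 :=
      Complex.exp_eq_one_iff.2 ⟨a, by rw [Cpi]; ring⟩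
    rw [Complex.exp_add, this, mul_one]
  obtain ⟨q, hq⟩ := exists_log_eq (-v)
  rw [RhatMod, RhatMod, ← QuotientAddGroup.mk_add]
  refine mk_eq_mk_of_sub (-(a * b) - 2 * a * q) ?_
  rw [chartZero, chartZero, h1, one_sub_exp_eq h, hq]
  push_cast
  linear_combination (2 * (a : ℂ) * b + 4 * a * q) * Cpi ^ 2 * I_sq

lemma continuousAt_chartZero {w : ℂ × ℂ} (h : 1 - Complex.exp w.1 ∈ slitPlane) :
    ContinuousAt (fun w : ℂ × ℂ => chartZero w.1 w.2) w := by
  have h1 : ContinuousAt (fun w : ℂ × ℂ => dilog (Complex.exp w.1)) w :=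
    ContinuousAt.comp (f := fun w : ℂ × ℂ => Complex.exp w.1) (continuousAt_dilog h) (by fun_prop)
  have h2 : ContinuousAt (fun w : ℂ × ℂ => Complex.log (1 - Complex.exp w.1)) w :=
    ContinuousAt.clog (by fun_prop) h
  unfold chartZero
  fun_prop

lemma continuousAt_chartOne {w : ℂ × ℂ} (h : Complex.exp w.1 ∈ slitPlane) :
    ContinuousAt (fun w : ℂ × ℂ => chartOne w.1 w.2) w := by
  have h1 : ContinuousAt (fun w : ℂ × ℂ => dilog (1 - Complex.exp w.1)) w :=
    ContinuousAt.comp (f := fun w : ℂ × ℂ => 1 - Complex.exp w.1)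
      (continuousAt_dilog (by simpa using h)) (by fun_prop)
  have h2 : ContinuousAt (fun w : ℂ × ℂ => Complex.log (Complex.exp w.1)) w :=
    ContinuousAt.clog (by fun_prop) h
  unfold chartOne
  fun_prop

lemma slit_or_slit (z : ℂ) : z ∈ slitPlane ∨ 1 - z ∈ slitPlane := by
  rw [mem_slitPlane_iff, mem_slitPlane_iff]
  simp only [sub_re, one_re]
  rcases lt_or_ge 0 z.re with h | h
  · exact Or.inl (Or.inl h)
  · exact Or.inr (Or.inl (by linarith))

lemma continuous_RhatMod : Continuous fun w : X00T => RhatMod w.1.1 w.1.2 := by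
  refine continuous_iff_continuousAt.2 fun w => ?_
  have hmk : Continuous (QuotientAddGroup.mk : ℂ → Mod2PiSq) := continuous_quot_mk
  rcases slit_or_slit (Complex.exp w.1.1) with h | h
  · refine ContinuousAt.congr (f := fun w : X00T => QuotientAddGroup.mk (chartOne w.1.1 w.1.2))
      (hmk.continuousAt.comp ((continuousAt_chartOne h).comp continuousAt_subtype_val)) ?_
    have : ∀ᶠ x : X00T in 𝓝 w, Complex.exp x.1.1 ∈ slitPlane :=
      ContinuousAt.eventually_mem (by fun_prop) (isOpen_slitPlane.mem_nhds h)
    filter_upwards [this] with x hx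
    exact (RhatMod_eq_chartOne (mem_X00_iff.1 x.2) hx).symm
  · exact hmk.continuousAt.comp ((continuousAt_chartZero h).comp continuousAt_subtype_val)

/-- Along a differentiable curve in `X₀₀`, `R̂` locally lifts to a primitive of
`(v du - u dv) / 2`. -/
lemma exists_local_lift {u v u' v' : ℝ → ℂ} {t : ℝ}
    (hu : ∀ᶠ s in 𝓝 t, HasDerivAt u (u' s) s) (hv : ∀ᶠ s in 𝓝 t, HasDerivAt v (v' s) s)
    (h : ∀ᶠ s in 𝓝 t, Complex.exp (u s) + Complex.exp (-v s) = 1) :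
    ∃ g : ℝ → ℂ, ∀ᶠ s in 𝓝 t, RhatMod (u s) (v s) = QuotientAddGroup.mk (g s) ∧
      HasDerivAt g ((v s * u' s - u s * v' s) / 2) s := by
  have hd : ∀ᶠ s in 𝓝 t, Complex.exp (u s) * u' s = Complex.exp (-v s) * v' s := by
    filter_upwards [hu, hv, h.eventually_nhds] with s hus hvs hs
    have h1 := (hus.cexp.add hvs.neg.cexp).congr_of_eventuallyEq
      (f₁ := fun _ => (1 : ℂ)) (hs.mono fun r hr => by simpa using hr.symm)
    have := h1.unique (hasDerivAt_const s (1 : ℂ))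
    linear_combination this
  have hcu : ContinuousAt (fun s => Complex.exp (u s)) t := hu.self_of_nhds.continuousAt.cexp
  rcases slit_or_slit (Complex.exp (u t)) with hs | hs
  · refine ⟨fun s => chartOne (u s) (v s), ?_⟩
    filter_upwards [hu, hv, h, hd, hcu.eventually_mem (isOpen_slitPlane.mem_nhds hs)]
      with s hus hvs hs hds hm
    refine ⟨RhatMod_eq_chartOne hs hm, ?_⟩
    have hne : 1 - Complex.exp (u s) ≠ 0 := by
      rw [one_sub_exp_eq hs]; exact Complex.exp_ne_zero _
    have e1 := HasDerivAt.comp (h₂ := dilog) s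
      (hasDerivAt_dilog hne (by simpa using hm)) (hus.cexp.const_sub 1)
    have e2 := hus.cexp.clog_real hm
    have := ((e1.neg).sub ((hus.mul hvs).div_const 2)).add (hvs.mul e2)
    convert! this using 1
    have := Complex.exp_ne_zero (u s)
    rw [sub_sub_cancel, one_sub_exp_eq hs]
    have h2 : -(-Complex.log (Complex.exp (u s)) / Complex.exp (-v s) * -(Complex.exp (u s) * u' s))
        = -Complex.log (Complex.exp (u s)) * v' s := by
      rw [hds]
      have := Complex.exp_ne_zero (-v s)
      field_simp
    rw [h2]
    field_simp
    ring
  · refine ⟨fun s => chartZero (u s) (v s), ?_⟩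
    filter_upwards [hu, hv, h, hd, (hcu.const_sub 1).eventually_mem (isOpen_slitPlane.mem_nhds hs)]
      with s hus hvs hs hds hm
    refine ⟨rfl, ?_⟩
    have e1 := HasDerivAt.comp (h₂ := dilog) s
      (hasDerivAt_dilog (Complex.exp_ne_zero _) hm) hus.cexp
    have e2 := (hus.cexp.const_sub 1).clog_real hm
    have := ((e1.add ((hus.mul hvs).div_const 2)).add (hus.mul e2)).sub_const (Cpi ^ 2 / 6)
    convert! this using 1
    have := Complex.exp_ne_zero (u s)
    rw [one_sub_exp_eq hs, hds]
    have := Complex.exp_ne_zero (-v s)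
    have h2 : -Complex.log (Complex.exp (-v s)) / Complex.exp (u s) * (Complex.exp (-v s) * v' s)
        = -Complex.log (Complex.exp (-v s)) * u' s := by
      rw [← hds]
      field_simp
    rw [h2]
    field_simp
    ring

/-- Tuples of branch values satisfying the five term relation on the level of logarithms. -/
structure IsFlat (w : Fin 5 → ℂ × ℂ) : Prop where
  mem_zero : w 0 ∈ X00
  mem_one : w 1 ∈ X00
  mem_two : w 2 ∈ X00
  fst_two : (w 2).1 = (w 1).1 - (w 0).1
  fst_three : (w 3).1 = (w 1).1 - (w 0).1 + (w 1).2 - (w 0).2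
  snd_three : (w 3).2 = (w 2).2 - (w 1).2
  fst_four : (w 4).1 = (w 1).2 - (w 0).2
  snd_four : (w 4).2 = (w 2).2 - (w 1).2 - (w 0).1

lemma IsFlat.mem {w : Fin 5 → ℂ × ℂ} (h : IsFlat w) (i : Fin 5) : w i ∈ X00 := by
  have h0 := mem_X00_iff.1 h.mem_zero
  have h1 := mem_X00_iff.1 h.mem_one
  have h2 := mem_X00_iff.1 h.mem_two
  rw [h.fst_two] at h2
  have n0 := Complex.exp_ne_zero (w 0).1
  have n1 := Complex.exp_ne_zero (-(w 0).2)
  have n2 := Complex.exp_ne_zero (-(w 1).2)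
  have h2' : Complex.exp (-(w 2).2) = 1 - Complex.exp (w 1).1 / Complex.exp (w 0).1 := by
    rw [← h2, Complex.exp_sub]; ring
  rw [← eq_sub_iff_add_eq] at h0 h1
  fin_cases i
  · exact h.mem_zero
  · exact h.mem_one
  · exact h.mem_two
  · refine mem_X00_iff.2 ?_
    change Complex.exp (w 3).1 + Complex.exp (-(w 3).2) = 1
    rw [h.fst_three, h.snd_three,
      show (w 1).1 - (w 0).1 + (w 1).2 - (w 0).2 = (w 1).1 - (w 0).1 + -(w 0).2 - -(w 1).2 by ring,
      show -((w 2).2 - (w 1).2) = -(w 2).2 - -(w 1).2 by ring, Complex.exp_sub, Complex.exp_sub,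
      Complex.exp_add, Complex.exp_sub, h2', h1]
    field_simp
    rw [h0]
    ring
  · refine mem_X00_iff.2 ?_
    change Complex.exp (w 4).1 + Complex.exp (-(w 4).2) = 1
    rw [h.fst_four, h.snd_four,
      show (w 1).2 - (w 0).2 = -(w 0).2 - -(w 1).2 by ring,
      show -((w 2).2 - (w 1).2 - (w 0).1) = -(w 2).2 - -(w 1).2 + (w 0).1 by ring,
      Complex.exp_add, Complex.exp_sub, Complex.exp_sub, h2', h1]
    field_simp
    rw [h0]
    ring

/-- The alternating five term sum of `R̂`. -/
def fiveTermSum (w : Fin 5 → ℂ × ℂ) : Mod2PiSq :=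
  ∑ i : Fin 5, (-1 : ℤ) ^ (i : ℕ) • RhatMod (w i).1 (w i).2

lemma fiveTermSum_eq (w : Fin 5 → ℂ × ℂ) : fiveTermSum w =
    RhatMod (w 0).1 (w 0).2 - RhatMod (w 1).1 (w 1).2 + RhatMod (w 2).1 (w 2).2
      - RhatMod (w 3).1 (w 3).2 + RhatMod (w 4).1 (w 4).2 := by
  simp [fiveTermSum, Fin.sum_univ_five, pow_succ, sub_eq_add_neg]

/-- Nearby logarithms can be joined by a curve whose exponential is affine. -/
lemma exists_log_curve {a b : ℂ} (hab : ‖b - a‖ < 1) :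
    ∃ c c' : ℝ → ℂ, c 0 = a ∧ c 1 = b ∧ ∀ t ∈ Set.Icc (0 : ℝ) 1, ∀ᶠ s in 𝓝 t,
      HasDerivAt c (c' s) s ∧
        Complex.exp (c s) = Complex.exp a + s * (Complex.exp b - Complex.exp a) := by
  set m := Complex.exp (b - a) - 1 with hm
  have him : |(b - a).im| < 1 := (abs_im_le_norm _).trans_lt hab
  have hpi := Real.pi_gt_three
  have hlog : Complex.log (Complex.exp (b - a)) = b - a :=
    log_exp (by linarith [(abs_lt.1 him).1]) (by linarith [(abs_lt.1 him).2])
  have hmem : Complex.exp (b - a) ∈ slitPlane := by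
    rw [mem_slitPlane_iff_arg]
    refine ⟨?_, Complex.exp_ne_zero _⟩
    rw [← log_im, hlog]
    linarith [(abs_lt.1 him).2]
  have hslit : ∀ t ∈ Set.Icc (0 : ℝ) 1, 1 + (t : ℂ) * m ∈ slitPlane := by
    intro t ht
    have := starConvex_one_slitPlane hmem (sub_nonneg.2 ht.2) ht.1 (by ring)
    convert this using 1
    simp only [hm, real_smul]
    push_cast
    ring
  refine ⟨fun s => a + Complex.log (1 + s * m), fun s => m / (1 + s * m), by simp, ?_, ?_⟩
  · simp [hm, hlog]
  · intro t ht
    have hc : ContinuousAt (fun s : ℝ => 1 + (s : ℂ) * m) t := by fun_prop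
    filter_upwards [hc.eventually_mem (isOpen_slitPlane.mem_nhds (hslit t ht))] with s hs
    constructor
    · have h1 : HasDerivAt (fun s : ℝ => 1 + (s : ℂ) * m) m s := by
        simpa using ((hasDerivAt_id s).ofReal_comp.mul_const m).const_add 1
      exact (h1.clog_real hs).const_add a
    · rw [Complex.exp_add, exp_log (slitPlane_ne_zero hs), hm, Complex.exp_sub]
      have := Complex.exp_ne_zero a
      field_simp

lemma eventually_eq_of_deriv_zero {g : ℝ → ℂ} {t : ℝ} (h : ∀ᶠ s in 𝓝 t, HasDerivAt g 0 s) :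
    ∀ᶠ s in 𝓝 t, g s = g t := by
  obtain ⟨ε, hε, hb⟩ := Metric.eventually_nhds_iff_ball.1 h
  refine Metric.eventually_nhds_iff_ball.2 ⟨ε, hε, fun s hs => ?_⟩
  exact Metric.isOpen_ball.is_const_of_deriv_eq_zero (convex_ball t ε).isPreconnected
    (fun x hx => (hb x hx).differentiableAt.differentiableWithinAt)
    (fun x hx => (hb x hx).deriv) hs (Metric.mem_ball_self hε)

/-- The five term sum is locally constant along differentiable curves of flat tuples. -/
lemma fiveTermSum_eventually_const {w : ℝ → Fin 5 → ℂ × ℂ} {u' v' : Fin 5 → ℝ → ℂ} {t : ℝ}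
    (hu : ∀ i, ∀ᶠ s in 𝓝 t, HasDerivAt (fun s => (w s i).1) (u' i s) s)
    (hv : ∀ i, ∀ᶠ s in 𝓝 t, HasDerivAt (fun s => (w s i).2) (v' i s) s)
    (h : ∀ᶠ s in 𝓝 t, IsFlat (w s)) :
    ∀ᶠ s in 𝓝 t, fiveTermSum (w s) = fiveTermSum (w t) := by
  have hg : ∀ i, ∃ g : ℝ → ℂ, ∀ᶠ s in 𝓝 t,
      RhatMod (w s i).1 (w s i).2 = QuotientAddGroup.mk (g s) ∧
        HasDerivAt g (((w s i).2 * u' i s - (w s i).1 * v' i s) / 2) s := fun i =>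
    exists_local_lift (hu i) (hv i) (h.mono fun s hs => mem_X00_iff.1 (hs.mem i))
  choose g hg using hg
  let G : ℝ → ℂ := fun s => g 0 s - g 1 s + g 2 s - g 3 s + g 4 s
  have hF : ∀ᶠ s in 𝓝 t, fiveTermSum (w s) = QuotientAddGroup.mk (G s) := by
    filter_upwards [hg 0, hg 1, hg 2, hg 3, hg 4] with s h0 h1 h2 h3 h4
    rw [fiveTermSum_eq, h0.1, h1.1, h2.1, h3.1, h4.1]
    rfl
  have hG : ∀ᶠ s in 𝓝 t, HasDerivAt G 0 s := by
    filter_upwards [hg 0, hg 1, hg 2, hg 3, hg 4, hu 0, hu 1, hu 2, hu 3, hu 4, hv 0, hv 1, hv 2,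
      hv 3, hv 4, h.eventually_nhds] with s h0 h1 h2 h3 h4 a0 a1 a2 a3 a4 b0 b1 b2 b3 b4 hs
    have hD := (((h0.2.sub h1.2).add h2.2).sub h3.2).add h4.2
    have e2 := a2.unique ((a1.sub a0).congr_of_eventuallyEq (hs.mono fun r hr => hr.fst_two))
    have e3 := a3.unique ((((a1.sub a0).add b1).sub b0).congr_of_eventuallyEq
      (hs.mono fun r hr => hr.fst_three))
    have e3' := b3.unique ((b2.sub b1).congr_of_eventuallyEq (hs.mono fun r hr => hr.snd_three))
    have e4 := a4.unique ((b1.sub b0).congr_of_eventuallyEq (hs.mono fun r hr => hr.fst_four))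
    have e4' := b4.unique (((b2.sub b1).sub a0).congr_of_eventuallyEq
      (hs.mono fun r hr => hr.snd_four))
    have hs' := hs.self_of_nhds
    convert! hD using 1
    rw [e2, e3, e3', e4, e4', hs'.fst_two, hs'.fst_three, hs'.snd_three, hs'.fst_four,
      hs'.snd_four]
    ring
  filter_upwards [hF, eventually_eq_of_deriv_zero hG] with s h1 h2
  rw [h1, h2, hF.self_of_nhds]

lemma fiveTermSum_eq_of_near {w w' : Fin 5 → ℂ × ℂ} (h : IsFlat w) (h' : IsFlat w')
    (hd : dist w' w < 1 / 2) : fiveTermSum w' = fiveTermSum w := by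
  have hi : ∀ i, dist (w' i) (w i) < 1 / 2 := fun i => (dist_le_pi_dist _ _ i).trans_lt hd
  have hu : ∀ i, ‖(w' i).1 - (w i).1‖ < 1 / 2 := fun i => by
    rw [← dist_eq_norm]; exact (le_max_left _ _).trans_lt (hi i)
  have hv : ∀ i, ‖(w' i).2 - (w i).2‖ < 1 / 2 := fun i => by
    rw [← dist_eq_norm]; exact (le_max_right _ _).trans_lt (hi i)
  have hn : ∀ i, ‖-(w' i).2 - -(w i).2‖ < 1 / 2 := fun i => by
    rw [neg_sub_neg, norm_sub_rev]; exact hv i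
  obtain ⟨X, X', X0, X1, hX⟩ := exists_log_curve (a := (w 0).1) (b := (w' 0).1)
    ((hu 0).trans (by norm_num))
  obtain ⟨A, A', A0, A1, hA⟩ := exists_log_curve (a := -(w 0).2) (b := -(w' 0).2) ((hn 0).trans (by norm_num))
  obtain ⟨Y, Y', Y0, Y1, hY⟩ := exists_log_curve (a := (w 1).1) (b := (w' 1).1)
    ((hu 1).trans (by norm_num))
  obtain ⟨B, B', B0, B1, hB⟩ := exists_log_curve (a := -(w 1).2) (b := -(w' 1).2) ((hn 1).trans (by norm_num))
  obtain ⟨D, D', D0, D1, hD⟩ := exists_log_curve (a := (w 0).1 - (w 2).2)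
    (b := (w' 0).1 - (w' 2).2) (by
      rw [show (w' 0).1 - (w' 2).2 - ((w 0).1 - (w 2).2)
        = ((w' 0).1 - (w 0).1) - ((w' 2).2 - (w 2).2) by ring]
      exact (norm_sub_le _ _).trans_lt (by linarith [hu 0, hv 2]))
  let c : ℝ → Fin 5 → ℂ × ℂ := fun s =>
    ![(X s, -A s), (Y s, -B s), (Y s - X s, X s - D s), (Y s - X s + -B s - -A s, X s - D s - -B s),
      (-B s - -A s, X s - D s - -B s - X s)]
  have hc0 : c 0 = w := by
    ext i : 1
    fin_cases i
    · simp [c, X0, A0]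
    · simp [c, Y0, B0]
    · exact Prod.ext (by simp [c, X0, Y0, h.fst_two]) (by simp [c, X0, D0])
    · exact Prod.ext (by simp [c, X0, Y0, A0, B0, h.fst_three, sub_eq_add_neg])
        (by simp [c, X0, D0, B0, h.snd_three, sub_eq_add_neg])
    · exact Prod.ext (by simp [c, A0, B0, h.fst_four, sub_eq_add_neg]) (by simp [c, X0, D0, B0, h.snd_four, sub_eq_add_neg])
  have hc1 : c 1 = w' := by
    ext i : 1
    fin_cases i
    · simp [c, X1, A1]
    · simp [c, Y1, B1]
    · exact Prod.ext (by simp [c, X1, Y1, h'.fst_two]) (by simp [c, X1, D1])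
    · exact Prod.ext (by simp [c, X1, Y1, A1, B1, h'.fst_three, sub_eq_add_neg])
        (by simp [c, X1, D1, B1, h'.snd_three, sub_eq_add_neg])
    · exact Prod.ext (by simp [c, A1, B1, h'.fst_four, sub_eq_add_neg]) (by simp [c, X1, D1, B1, h'.snd_four, sub_eq_add_neg])
  have key : ∀ {z : Fin 5 → ℂ × ℂ}, IsFlat z →
      Complex.exp ((z 0).1 - (z 2).2) = Complex.exp (z 0).1 - Complex.exp (z 1).1 := by
    intro z hz
    have h2 := mem_X00_iff.1 hz.mem_two
    rw [hz.fst_two, Complex.exp_sub] at h2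
    have := Complex.exp_ne_zero (z 0).1
    rw [sub_eq_add_neg, Complex.exp_add, ← sub_eq_iff_eq_add'.2 h2.symm]
    field_simp
  have hloc : ∀ t ∈ Set.Icc (0 : ℝ) 1, ∀ᶠ s in 𝓝[Set.Icc (0 : ℝ) 1] t,
      fiveTermSum (c s) = fiveTermSum (c t) := by
    intro t ht
    refine Filter.Eventually.filter_mono nhdsWithin_le_nhds ?_
    refine fiveTermSum_eventually_const
      (u' := ![X', Y', fun s => Y' s - X' s, fun s => Y' s - X' s + -B' s - -A' s,
        fun s => -B' s - -A' s])
      (v' := ![fun s => -A' s, fun s => -B' s, fun s => X' s - D' s, fun s => X' s - D' s - -B' s,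
        fun s => X' s - D' s - -B' s - X' s]) ?_ ?_ ?_
    · intro i
      filter_upwards [hX t ht, hA t ht, hY t ht, hB t ht] with s hx ha hy hb
      fin_cases i
      · exact hx.1
      · exact hy.1
      · exact hy.1.sub hx.1
      · exact ((hy.1.sub hx.1).add hb.1.neg).sub ha.1.neg
      · exact hb.1.neg.sub ha.1.neg
    · intro i
      filter_upwards [hX t ht, hA t ht, hB t ht, hD t ht] with s hx ha hb hd
      fin_cases i
      · exact ha.1.neg
      · exact hb.1.neg
      · exact hx.1.sub hd.1
      · exact (hx.1.sub hd.1).sub hb.1.neg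
      · exact ((hx.1.sub hd.1).sub hb.1.neg).sub hx.1
    · filter_upwards [hX t ht, hA t ht, hY t ht, hB t ht, hD t ht] with s hx ha hy hb hd
      have k0 := mem_X00_iff.1 h.mem_zero
      have k0' := mem_X00_iff.1 h'.mem_zero
      have k1 := mem_X00_iff.1 h.mem_one
      have k1' := mem_X00_iff.1 h'.mem_one
      refine ⟨mem_X00_iff.2 ?_, mem_X00_iff.2 ?_, mem_X00_iff.2 ?_, rfl, rfl, rfl, rfl, rfl⟩
      · simp only [c, Matrix.cons_val, neg_neg]
        rw [hx.2, ha.2]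
        linear_combination k0 + (s : ℂ) * (k0' - k0)
      · simp only [c, Matrix.cons_val, neg_neg]
        rw [hy.2, hb.2]
        linear_combination k1 + (s : ℂ) * (k1' - k1)
      · simp only [c, Matrix.cons_val, neg_sub]
        have e := hd.2
        rw [key h, key h'] at e
        rw [Complex.exp_sub, Complex.exp_sub, ← add_div, div_eq_one_iff_eq (Complex.exp_ne_zero _),
          hx.2, hy.2, e]
        ring
  rw [← hc0, ← hc1]
  exact const_of_locally_const isPreconnected_Icc hloc (by simp) (by simp)

/-- The five term sum is constant on preconnected sets of flat tuples. -/
lemma fiveTermSum_const {S : Set (Fin 5 → ℂ × ℂ)} (hS : IsPreconnected S)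
    (h : ∀ w ∈ S, IsFlat w) {w w' : Fin 5 → ℂ × ℂ} (hw : w ∈ S) (hw' : w' ∈ S) :
    fiveTermSum w = fiveTermSum w' := by
  refine const_of_locally_const hS (fun z hz => ?_) hw hw'
  filter_upwards [self_mem_nhdsWithin,
    mem_nhdsWithin_of_mem_nhds (Metric.ball_mem_nhds z (by norm_num : (0 : ℝ) < 1 / 2))] with y hy hb
  exact fiveTermSum_eq_of_near (h z hz) (h y hy) hb

lemma log_im_mem {z : ℂ} (hz : 0 < z.im) :
    0 < (Complex.log z).im ∧ (Complex.log z).im < Real.pi := by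
  rw [log_im]
  refine ⟨lt_of_le_of_ne (arg_nonneg_iff.2 hz.le) fun h => ?_, arg_lt_pi_iff.2 (Or.inr hz.ne')⟩
  exact hz.ne (arg_eq_zero_iff.1 h.symm).2.symm

lemma neg_log_one_sub_im_mem {z : ℂ} (hz : 0 < z.im) :
    0 < (-Complex.log (1 - z)).im ∧ (-Complex.log (1 - z)).im < Real.pi := by
  rw [neg_im, log_im]
  have : arg (1 - z) < 0 := arg_neg_iff.2 (by simpa using hz)
  exact ⟨by linarith, by linarith [neg_pi_lt_arg (1 - z)]⟩

lemma add_eq_of_exp_eq {a b c : ℂ} (ha : 0 < a.im ∧ a.im < Real.pi)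
    (hb : 0 < b.im ∧ b.im < Real.pi) (hc : 0 < c.im ∧ c.im < Real.pi)
    (h : Complex.exp a * Complex.exp b = Complex.exp c) : a + b = c := by
  rw [← Complex.exp_add] at h
  obtain ⟨n, hn⟩ := Complex.exp_eq_exp_iff_exists_int.1 h
  have him := congrArg Complex.im hn
  simp at him
  have hpi := Real.pi_pos
  have h1 : (n : ℝ) < 1 := by
    by_contra! h1
    nlinarith
  have h2 : (-1 : ℝ) < n := by
    by_contra! h1
    nlinarith
  have : n = 0 := by
    have h1' : n < 1 := by exact_mod_cast h1
    have h2' : -1 < n := by exact_mod_cast h2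
    omega
  simpa [this] using hn

lemma reg_of_im_pos {z : ℂ} (h : 0 < z.im) : Reg z :=
  ⟨fun h0 => by simp [h0] at h, fun h1 => by simp [h1] at h⟩

lemma pt_zero_mem_X00 {z : ℂ} (h : Reg z) : pt z 0 0 ∈ X00 := by
  simpa using pt_mem_X00 h 0 0

lemma ftTuple_identities {x y : ℂ} (hx : x ≠ 0) (hy : y ≠ 0) (hy1 : 1 - y ≠ 0) :
    (1 - x⁻¹) / (1 - y⁻¹) = y * (1 - x) / (x * (1 - y)) ∧
    1 - y / x = (x - y) / x ∧
    1 - (1 - x⁻¹) / (1 - y⁻¹) = (x - y) / (x * (1 - y)) ∧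
    1 - (1 - x) / (1 - y) = (x - y) / (1 - y) := by
  have e3 : (1 - x⁻¹) / (1 - y⁻¹) = y * (1 - x) / (x * (1 - y)) := by
    have hy1' : y - 1 ≠ 0 := sub_ne_zero.2 (sub_ne_zero.1 hy1).symm
    have : 1 - y⁻¹ ≠ 0 := by
      rw [show 1 - y⁻¹ = (y - 1) / y by field_simp]
      exact div_ne_zero hy1' hy
    field_simp
    ring
  refine ⟨e3, by field_simp, ?_, by field_simp; ring⟩
  rw [e3]
  field_simp
  ring

lemma isFlat_of_im_pos {x y : ℂ} (h : ∀ i, 0 < (ftTuple x y i).im) :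
    IsFlat fun i => pt (ftTuple x y i) 0 0 := by
  have hr : ∀ i, Reg (ftTuple x y i) := fun i => reg_of_im_pos (h i)
  have eL : ∀ i, Complex.exp (pt (ftTuple x y i) 0 0).1 = ftTuple x y i := fun i => by
    simp [pt, exp_log (hr i).1]
  have eM : ∀ i, Complex.exp (pt (ftTuple x y i) 0 0).2 = (1 - ftTuple x y i)⁻¹ := fun i => by
    simp [pt, Complex.exp_neg, exp_log (sub_ne_zero.2 (hr i).2.symm)]
  have iL : ∀ i, 0 < (pt (ftTuple x y i) 0 0).1.im ∧ (pt (ftTuple x y i) 0 0).1.im < Real.pi :=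
    fun i => by simpa [pt] using log_im_mem (h i)
  have iM : ∀ i, 0 < (pt (ftTuple x y i) 0 0).2.im ∧ (pt (ftTuple x y i) 0 0).2.im < Real.pi :=
    fun i => by simpa [pt] using neg_log_one_sub_im_mem (h i)
  have hx : x ≠ 0 := (hr 0).1
  have hx1 : 1 - x ≠ 0 := sub_ne_zero.2 (hr 0).2.symm
  have hy : y ≠ 0 := (hr 1).1
  have hy1 : 1 - y ≠ 0 := sub_ne_zero.2 (hr 1).2.symm
  have hxy : x - y ≠ 0 := fun h0 => (hr 2).2 (by
    change y / x = 1
    rw [← sub_eq_zero.1 h0, div_self hx])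
  obtain ⟨e3, f2, f3, f4⟩ := ftTuple_identities hx hy hy1
  have r1 := add_eq_of_exp_eq (iL 0) (iL 2) (iL 1) (by
    rw [eL, eL, eL]
    simp only [ftTuple, Matrix.cons_val]
    field_simp)
  have r2 := add_eq_of_exp_eq (iM 0) (iL 4) (iM 1) (by
    rw [eM, eL, eM]
    simp only [ftTuple, Matrix.cons_val]
    field_simp)
  have r3 := add_eq_of_exp_eq (iL 2) (iL 4) (iL 3) (by
    rw [eL, eL, eL]
    simp only [ftTuple, Matrix.cons_val]
    rw [e3]
    field_simp)
  have r4 := add_eq_of_exp_eq (iM 1) (iM 3) (iM 2) (by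
    rw [eM, eM, eM]
    simp only [ftTuple, Matrix.cons_val]
    rw [f3, f2]
    field_simp)
  have r5 := add_eq_of_exp_eq (iM 4) (iL 0) (iM 3) (by
    rw [eM, eL, eM]
    simp only [ftTuple, Matrix.cons_val]
    rw [f3, f4]
    field_simp)
  refine ⟨pt_zero_mem_X00 (hr 0), pt_zero_mem_X00 (hr 1), pt_zero_mem_X00 (hr 2), ?_, ?_, ?_, ?_, ?_⟩
  · linear_combination r1
  · linear_combination r1 + r2 - r3
  · linear_combination r4
  · linear_combination r2
  · linear_combination r4 + r5

lemma exp_int_mul_pi_I (n : ℤ) :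
    Complex.exp (n * (Cpi * I)) = 1 ∨ Complex.exp (n * (Cpi * I)) = -1 := by
  refine mul_self_eq_one_iff.1 ?_
  rw [← Complex.exp_add]
  exact Complex.exp_eq_one_iff.2 ⟨n, by rw [Cpi]; ring⟩

lemma exp_of_liesOver {w : ℂ × ℂ} {z : ℂ} (h : LiesOver w z) :
    (Complex.exp w.1 = z ∨ Complex.exp w.1 = -z) ∧
      (Complex.exp (-w.2) = 1 - z ∨ Complex.exp (-w.2) = -(1 - z)) := by
  obtain ⟨hz, p, q, rfl⟩ := h
  constructor
  · rw [pt, Complex.exp_add, exp_log hz.1]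
    rcases exp_int_mul_pi_I p with h | h <;> simp [h]
  · rw [pt, neg_add, neg_neg, Complex.exp_add, exp_log (sub_ne_zero.2 hz.2.symm), ← neg_mul,
      ← Int.cast_neg]
    rcases exp_int_mul_pi_I (-q) with h | h <;> rw [h] <;> simp

lemma eq_of_liesOver_of_mem {w : ℂ × ℂ} {z : ℂ} (h : LiesOver w z) (hw : w ∈ X00) :
    Complex.exp w.1 = z ∧ Complex.exp (-w.2) = 1 - z := by
  have hs := mem_X00_iff.1 hw
  obtain ⟨h0, h1⟩ := h.1
  obtain ⟨a | a, b | b⟩ := exp_of_liesOver h <;> rw [a, b] at hs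
  · exact ⟨a, b⟩
  · exact absurd (by linear_combination hs / 2) h1
  · exact absurd (by linear_combination -hs / 2) h0
  · have : (2 : ℂ) = 0 := by linear_combination -hs
    norm_num at this

lemma sum_cases_of_mem_cover {w : ℂ × ℂ} (h : w ∈ Cover) :
    w ∈ X00 ∨ Complex.exp w.1 - Complex.exp (-w.2) = 1 ∨
      -Complex.exp w.1 + Complex.exp (-w.2) = 1 ∨ -Complex.exp w.1 - Complex.exp (-w.2) = 1 := by
  rw [mem_X00_iff]
  obtain ⟨z, hz, hpq⟩ := h
  obtain ⟨a | a, b | b⟩ := exp_of_liesOver (w := w) ⟨hz, hpq⟩ <;> rw [a, b]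
  · exact Or.inl (by ring)
  · exact Or.inr (Or.inl (by ring))
  · exact Or.inr (Or.inr (Or.inl (by ring)))
  · exact Or.inr (Or.inr (Or.inr (by ring)))

/-- `X₀₀` is open and closed in `𝓒`. -/
lemma eventually_mem_X00_iff (w : ℂ × ℂ) :
    ∀ᶠ w' in 𝓝 w, w' ∈ Cover → (w' ∈ X00 ↔ w ∈ X00) := by
  have hc : Continuous fun w : ℂ × ℂ => Complex.exp w.1 := by fun_prop
  have hd : Continuous fun w : ℂ × ℂ => Complex.exp (-w.2) := by fun_prop
  by_cases hw : w ∈ X00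
  · have hs := mem_X00_iff.1 hw
    have n1 : Complex.exp w.1 - Complex.exp (-w.2) ≠ 1 := fun h =>
      Complex.exp_ne_zero (-w.2) (by linear_combination (hs - h) / 2)
    have n2 : -Complex.exp w.1 + Complex.exp (-w.2) ≠ 1 := fun h =>
      Complex.exp_ne_zero w.1 (by linear_combination (hs - h) / 2)
    have n3 : -Complex.exp w.1 - Complex.exp (-w.2) ≠ 1 := fun h => by
      have : (0 : ℂ) = 2 := by linear_combination hs + h
      norm_num at this
    filter_upwards [(hc.sub hd).continuousAt.eventually_ne n1,
      (hc.neg.add hd).continuousAt.eventually_ne n2,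
      (hc.neg.sub hd).continuousAt.eventually_ne n3] with w' h1 h2 h3 hw'
    have := sum_cases_of_mem_cover hw'
    tauto
  · filter_upwards [(hc.add hd).continuousAt.eventually_ne fun h => hw (mem_X00_iff.2 h)]
      with w' h1 _
    exact iff_of_false (fun h => h1 (mem_X00_iff.1 h)) hw

lemma eq_zero_of_exp_eq_one {X : Type*} [TopologicalSpace X] {S : Set X} (hS : IsPreconnected S)
    {f : X → ℂ} (hf : Continuous f) (he : ∀ w ∈ S, Complex.exp (f w) = 1) {w₀ : X} (h₀ : w₀ ∈ S)
    (hf₀ : f w₀ = 0) {w : X} (hw : w ∈ S) : f w = 0 := by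
  rw [← hf₀]
  refine const_of_locally_const hS (fun a ha => ?_) hw h₀
  filter_upwards [self_mem_nhdsWithin, mem_nhdsWithin_of_mem_nhds
    (hf.continuousAt (Metric.ball_mem_nhds (f a) one_pos))] with b hb hd
  have h1 : Complex.exp (f b - f a) = 1 := by rw [Complex.exp_sub, he b hb, he a ha, div_one]
  obtain ⟨n, hn⟩ := Complex.exp_eq_one_iff.1 h1
  have hd' : ‖f b - f a‖ < 1 := by simpa [dist_eq_norm] using hd
  have h2 : n = 0 := by
    by_contra h2
    have h3 : (1 : ℝ) ≤ |(n : ℝ)| := by exact_mod_cast Int.one_le_abs h2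
    rw [hn] at hd'
    simp [abs_of_pos Real.pi_pos] at hd'
    nlinarith [Real.pi_gt_three]
  rw [h2] at hn
  exact sub_eq_zero.1 (by simpa using hn)

/-- The last coordinate along the path from the base point (`ε = 1`) to a degenerate tuple. -/
lemma degenerate_four (ε : ℝ) : (1 - (ε : ℂ) * ((1 + I) / 4)) / (1 - ε * I) =
    ((1 - ε / 4 + ε ^ 2 / 4 : ℝ) + (3 * ε / 4 - ε ^ 2 / 4 : ℝ) * I) / (1 + ε ^ 2 : ℝ) := by
  have h1 : (1 - (ε : ℂ) * I) ≠ 0 := fun h => by simpa using congrArg Complex.re h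
  have h2 : ((1 + ε ^ 2 : ℝ) : ℂ) ≠ 0 := by
    have : 0 < 1 + ε ^ 2 := by positivity
    exact_mod_cast this.ne'
  rw [div_eq_div_iff h1 h2]
  push_cast
  linear_combination (3 * (ε : ℂ) ^ 2 / 4 - ε ^ 3 / 4) * I_sq

lemma ftTuple_degenerate {ε : ℝ} (hε : 0 < ε) :
    ftTuple (ε * ((1 + I) / 4)) (ε * I) =
      ![ε * ((1 + I) / 4), ε * I, 2 + 2 * I,
        (2 + 2 * I) * ((1 - (ε : ℂ) * ((1 + I) / 4)) / (1 - ε * I)),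
        (1 - (ε : ℂ) * ((1 + I) / 4)) / (1 - ε * I)] := by
  have h0 : (ε : ℂ) ≠ 0 := by exact_mod_cast hε.ne'
  have h1 : (1 - (ε : ℂ) * I) ≠ 0 := fun h => by simpa using congrArg Complex.re h
  have h1' : ((ε : ℂ) * I - 1) ≠ 0 := fun h => by simpa using congrArg Complex.re h
  have h2 : (1 + I : ℂ) ≠ 0 := fun h => by simpa using congrArg Complex.re h
  have h3 := I_ne_zero
  have h4 : 1 - ((ε : ℂ) * I)⁻¹ = -(1 - ε * I) / (ε * I) := by field_simp; ring
  have h5 : ε * I / (ε * ((1 + I) / 4)) = 2 + 2 * I := by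
    rw [div_eq_iff (mul_ne_zero h0 (div_ne_zero h2 (by norm_num)))]
    linear_combination -(ε : ℂ) / 2 * I_sq
  have h6 : (1 - ((ε : ℂ) * ((1 + I) / 4))⁻¹) / (1 - ((ε : ℂ) * I)⁻¹) =
      (2 + 2 * I) * ((1 - (ε : ℂ) * ((1 + I) / 4)) / (1 - ε * I)) := by
    rw [h4, ← h5]
    field_simp
    ring
  rw [ftTuple, h5, h6]

lemma im_degenerate_pos {ε : ℝ} (hε : 0 < ε) (h1 : ε ≤ 1) (i : Fin 5) :
    0 < (ftTuple (ε * ((1 + I) / 4)) (ε * I) i).im := by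
  have hre : 0 < (1 - ε / 4 + ε ^ 2 / 4) / (1 + ε ^ 2) := div_pos (by nlinarith) (by positivity)
  have him : 0 < (3 * ε / 4 - ε ^ 2 / 4) / (1 + ε ^ 2) := div_pos (by nlinarith) (by positivity)
  rw [ftTuple_degenerate hε, degenerate_four]
  have e : ((1 - ε / 4 + ε ^ 2 / 4 : ℝ) + (3 * ε / 4 - ε ^ 2 / 4 : ℝ) * I) / (1 + ε ^ 2 : ℝ) =
      (⟨(1 - ε / 4 + ε ^ 2 / 4) / (1 + ε ^ 2), (3 * ε / 4 - ε ^ 2 / 4) / (1 + ε ^ 2)⟩ : ℂ) := by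
    rw [mk_eq_add_mul_I]
    push_cast
    ring
  rw [e]
  fin_cases i
  · change 0 < ((ε : ℂ) * ((1 + I) / 4)).im
    rw [im_ofReal_mul]
    simpa using hε
  · simpa using hε
  · simp
  · simp
    linarith
  · exact him

lemma basePt_eq : basePt = fun i => pt (ftTuple ((1 : ℝ) * ((1 + I) / 4)) ((1 : ℝ) * I) i) 0 0 := by
  simp only [ofReal_one, one_mul]
  rfl

lemma basePt_isFlat : IsFlat basePt := by
  rw [basePt_eq]
  exact isFlat_of_im_pos (im_degenerate_pos one_pos le_rfl)

/-- `𝓡(z) - π²/6`, the value of `R̂` on the principal sheet. -/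
def principalRhat (z : ℂ) : ℂ :=
  dilog z + Complex.log z * Complex.log (1 - z) / 2 - (Real.pi : ℂ) ^ 2 / 6

lemma RhatMod_pt_zero {z : ℂ} (h : Reg z) :
    RhatMod (pt z 0 0).1 (pt z 0 0).2 = QuotientAddGroup.mk (principalRhat z) := by
  have := RhatMod_pt z h 0 0
  rw [mul_zero] at this
  rw [this]
  refine congrArg _ ?_
  rw [Rhat, rogers, principalRhat, dilog, Cpi]
  push_cast
  ring

lemma tendsto_principalRhat_zero :
    Tendsto principalRhat (𝓝 0) (𝓝 (-((Real.pi : ℂ) ^ 2 / 6))) := by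
  have h1 : Tendsto dilog (𝓝 0) (𝓝 (dilog 0)) := (continuousAt_dilog (by simp)).tendsto
  have := (h1.add (tendsto_log_mul_log_zero.div_const 2)).sub_const ((Real.pi : ℂ) ^ 2 / 6)
  rw [dilog_zero] at this
  simpa using! this

lemma tendsto_principalRhat_one {f : ℝ → ℂ} {l : Filter ℝ} (hf : Tendsto f l (𝓝 1))
    (hs : ∀ᶠ s in l, f s ∈ slitPlane ∧ f s ≠ 1) :
    Tendsto (fun s => principalRhat (f s)) l (𝓝 0) := by
  have h1 : Tendsto (fun s => dilog (1 - f s)) l (𝓝 (dilog 0)) := by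
    refine (continuousAt_dilog (by simp)).tendsto.comp ?_
    simpa using hf.const_sub 1
  have h2 := tendsto_log_mul_log_one.comp hf
  have h3 := h1.neg.sub (h2.div_const 2)
  rw [dilog_zero] at h3
  simp only [neg_zero, zero_div, sub_zero] at h3
  refine h3.congr' ?_
  filter_upwards [hs] with s hs
  have := dilog_reflection hs.1 hs.2
  simp only [principalRhat, Function.comp]
  linear_combination -this

lemma continuousAt_principalRhat {z : ℂ} (h : 0 < z.im) : ContinuousAt principalRhat z := by
  have h1 : z ∈ slitPlane := Or.inr h.ne'
  have h2 : 1 - z ∈ slitPlane := Or.inr (by simpa using h.ne')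
  have h3 := continuousAt_dilog h2
  have h4 : ContinuousAt Complex.log z := continuousAt_clog h1
  have h5 : ContinuousAt (fun z => Complex.log (1 - z)) z := ContinuousAt.clog (by fun_prop) h2
  unfold principalRhat
  fun_prop

instance isClosed_zmultiples_two_mul_Cpi_sq :
    IsClosed (AddSubgroup.zmultiples (2 * Cpi ^ 2) : Set ℂ) :=
  AddSubgroup.isClosed_of_discrete

lemma fiveTermSum_basePt : fiveTermSum basePt = 0 := by
  let c : ℝ → Fin 5 → ℂ × ℂ := fun ε i => pt (ftTuple (ε * ((1 + I) / 4)) (ε * I) i) 0 0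
  let f : ℝ → ℂ := fun ε => (1 - (ε : ℂ) * ((1 + I) / 4)) / (1 - ε * I)
  let G : ℝ → ℂ := fun ε => principalRhat (ε * ((1 + I) / 4)) - principalRhat (ε * I) +
    principalRhat (2 + 2 * I) - principalRhat ((2 + 2 * I) * f ε) + principalRhat (f ε)
  have hcont : ContinuousOn c (Set.Ioc 0 1) := by
    refine continuousOn_pi.2 fun i => ?_
    have hz : ContinuousOn (fun ε : ℝ => ftTuple (ε * ((1 + I) / 4)) (ε * I) i) (Set.Ioc 0 1) := by
      have h2 : ∀ ε : ℝ, 1 - (ε : ℂ) * I ≠ 0 := fun ε h => by simpa using congrArg Complex.re h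
      have h3 : ContinuousOn f (Set.Ioc 0 1) :=
        ContinuousOn.div (by fun_prop) (by fun_prop) fun ε _ => h2 ε
      have hrw : Set.EqOn (fun ε : ℝ => ftTuple (ε * ((1 + I) / 4)) (ε * I) i)
          (fun ε : ℝ => ![ε * ((1 + I) / 4), ε * I, 2 + 2 * I, (2 + 2 * I) * f ε, f ε] i)
          (Set.Ioc 0 1) := fun ε hε => by simp only [ftTuple_degenerate hε.1, f]
      refine ContinuousOn.congr ?_ hrw
      fin_cases i
      · change ContinuousOn (fun ε : ℝ => (ε : ℂ) * ((1 + I) / 4)) _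
        fun_prop
      · change ContinuousOn (fun ε : ℝ => (ε : ℂ) * I) _
        fun_prop
      · exact continuousOn_const
      · exact continuousOn_const.mul h3
      · exact h3
    have hL := hz.clog fun ε hε => Or.inr (im_degenerate_pos hε.1 hε.2 i).ne'
    have hM := (continuousOn_const.sub hz).clog (f := fun ε : ℝ =>
      1 - ftTuple (ε * ((1 + I) / 4)) (ε * I) i)
      fun ε hε => Or.inr (by simpa using (im_degenerate_pos hε.1 hε.2 i).ne')
    exact (hL.add continuousOn_const).prodMk (hM.neg.add continuousOn_const)
  have hconst : ∀ ε ∈ Set.Ioc (0 : ℝ) 1, fiveTermSum basePt = QuotientAddGroup.mk (G ε) := by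
    intro ε hε
    have h1 : fiveTermSum basePt = fiveTermSum (c ε) := by
      refine fiveTermSum_const (isPreconnected_Ioc.image c hcont) ?_
        ⟨1, by simp, basePt_eq.symm⟩ ⟨ε, hε, rfl⟩
      rintro _ ⟨δ, hδ, rfl⟩
      exact isFlat_of_im_pos (im_degenerate_pos hδ.1 hδ.2)
    have h2 : ∀ i, RhatMod (c ε i).1 (c ε i).2 =
        QuotientAddGroup.mk (principalRhat (ftTuple (ε * ((1 + I) / 4)) (ε * I) i)) :=
      fun i => RhatMod_pt_zero (reg_of_im_pos (im_degenerate_pos hε.1 hε.2 i))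
    rw [h1, fiveTermSum_eq]
    simp only [h2, ftTuple_degenerate hε.1]
    rfl
  have hf : Tendsto f (𝓝[>] 0) (𝓝 1) := by
    have : ContinuousAt f 0 := ContinuousAt.div (by fun_prop) (by fun_prop) (by simp)
    have h := this.tendsto.mono_left (nhdsWithin_le_nhds (s := Set.Ioi 0))
    simpa [f] using h
  have hIoc : ∀ᶠ ε in 𝓝[>] (0 : ℝ), ε ∈ Set.Ioc (0 : ℝ) 1 := Ioc_mem_nhdsGT one_pos
  have hG : Tendsto G (𝓝[>] 0) (𝓝 0) := by
    have l0 : Tendsto (fun ε : ℝ => principalRhat (ε * ((1 + I) / 4))) (𝓝[>] 0)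
        (𝓝 (-((Real.pi : ℂ) ^ 2 / 6))) := by
      refine tendsto_principalRhat_zero.comp (tendsto_nhdsWithin_of_tendsto_nhds ?_)
      exact Continuous.tendsto' (by fun_prop) _ _ (by simp)
    have l1 : Tendsto (fun ε : ℝ => principalRhat (ε * I)) (𝓝[>] 0)
        (𝓝 (-((Real.pi : ℂ) ^ 2 / 6))) := by
      refine tendsto_principalRhat_zero.comp (tendsto_nhdsWithin_of_tendsto_nhds ?_)
      exact Continuous.tendsto' (by fun_prop) _ _ (by simp)
    have l3 : Tendsto (fun ε => principalRhat ((2 + 2 * I) * f ε)) (𝓝[>] 0)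
        (𝓝 (principalRhat (2 + 2 * I))) := by
      refine (continuousAt_principalRhat (by simp)).tendsto.comp ?_
      simpa using hf.const_mul (2 + 2 * I)
    have l4 := tendsto_principalRhat_one hf (hIoc.mono fun ε hε => by
      have him := im_degenerate_pos hε.1 hε.2 4
      rw [ftTuple_degenerate hε.1] at him
      exact ⟨Or.inr (ne_of_gt him), (reg_of_im_pos him).2⟩)
    have := (((l0.sub l1).add_const (principalRhat (2 + 2 * I))).sub l3).add l4
    simpa using! this
  have hmk : Continuous (QuotientAddGroup.mk : ℂ → Mod2PiSq) := continuous_quot_mk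
  refine tendsto_nhds_unique (tendsto_const_nhds (f := 𝓝[>] (0 : ℝ))) ?_
  refine ((hmk.tendsto 0).comp hG).congr' (hIoc.mono fun ε hε => (hconst ε hε).symm)

lemma FThat₀_subset : FThat₀ ⊆ FTpre := connectedComponentIn_subset _ _

lemma basePt_mem_FThat₀ {w : Fin 5 → ℂ × ℂ} (hw : w ∈ FThat₀) : basePt ∈ FThat₀ :=
  mem_connectedComponentIn (connectedComponentIn_nonempty_iff.1 ⟨w, hw⟩)

lemma isPreconnected_FThat₀ : IsPreconnected FThat₀ := isPreconnected_connectedComponentIn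

lemma mem_X00_of_mem_FThat₀ {w : Fin 5 → ℂ × ℂ} (hw : w ∈ FThat₀) (i : Fin 5) : w i ∈ X00 := by
  have h : (w i ∈ X00) = (basePt i ∈ X00) := by
    refine const_of_locally_const isPreconnected_FThat₀ (f := fun w => w i ∈ X00) (fun a _ => ?_)
      hw (basePt_mem_FThat₀ hw)
    have := ((continuous_apply i).tendsto a).eventually (eventually_mem_X00_iff (a i))
    filter_upwards [self_mem_nhdsWithin, mem_nhdsWithin_of_mem_nhds this] with b hb h
    obtain ⟨v, -, hv⟩ := FThat₀_subset hb
    exact propext (h ⟨v i, hv i⟩)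
  rw [h]
  exact basePt_isFlat.mem i

/-- The five term relation between the branch values of a point of `𝓕𝓣̂₀`, up to `2πiℤ`. -/
lemma exp_relations {w : Fin 5 → ℂ × ℂ} (hw : w ∈ FThat₀) :
    Complex.exp ((w 2).1 - ((w 1).1 - (w 0).1)) = 1 ∧
    Complex.exp ((w 3).1 - ((w 1).1 - (w 0).1 + (w 1).2 - (w 0).2)) = 1 ∧
    Complex.exp ((w 3).2 - ((w 2).2 - (w 1).2)) = 1 ∧
    Complex.exp ((w 4).1 - ((w 1).2 - (w 0).2)) = 1 ∧
    Complex.exp ((w 4).2 - ((w 2).2 - (w 1).2 - (w 0).1)) = 1 := by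
  obtain ⟨_, ⟨x, y, hx, hy, hxy, rfl⟩, hv⟩ := FThat₀_subset hw
  have e : ∀ i, Complex.exp (w i).1 = ftTuple x y i ∧ Complex.exp (-(w i).2) = 1 - ftTuple x y i :=
    fun i => eq_of_liesOver_of_mem (hv i) (mem_X00_of_mem_FThat₀ hw i)
  have e' : ∀ i, Complex.exp (w i).2 = (1 - ftTuple x y i)⁻¹ := fun i => by
    rw [← (e i).2, Complex.exp_neg, inv_inv]
  obtain ⟨hx0, hx1⟩ := hx
  obtain ⟨hy0, hy1⟩ := hy
  have hx1 : 1 - x ≠ 0 := sub_ne_zero.2 (Ne.symm hx1)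
  have hy1 : 1 - y ≠ 0 := sub_ne_zero.2 (Ne.symm hy1)
  have hxy : x - y ≠ 0 := sub_ne_zero.2 hxy
  obtain ⟨e3, f2, f3, f4⟩ := ftTuple_identities hx0 hy0 hy1
  simp only [Complex.exp_sub, Complex.exp_add, e', (e _).1, ftTuple, Matrix.cons_val, e3, f2, f4]
  rw [← e3, f3, e3]
  refine ⟨?_, ?_, ?_, ?_, ?_⟩ <;> field_simp

lemma isFlat_of_mem_FThat₀ {w : Fin 5 → ℂ × ℂ} (hw : w ∈ FThat₀) : IsFlat w := by
  have key : ∀ {f : (Fin 5 → ℂ × ℂ) → ℂ}, Continuous f →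
      (∀ w ∈ FThat₀, Complex.exp (f w) = 1) → f basePt = 0 → f w = 0 := fun hf he h0 =>
    eq_zero_of_exp_eq_one isPreconnected_FThat₀ hf he (basePt_mem_FThat₀ hw) h0 hw
  have hb := basePt_isFlat
  refine ⟨mem_X00_of_mem_FThat₀ hw 0, mem_X00_of_mem_FThat₀ hw 1, mem_X00_of_mem_FThat₀ hw 2,
    ?_, ?_, ?_, ?_, ?_⟩ <;> refine sub_eq_zero.1 ?_
  · exact key (f := fun w => (w 2).1 - ((w 1).1 - (w 0).1)) (by fun_prop)
      (fun w h => (exp_relations h).1) (sub_eq_zero.2 hb.fst_two)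
  · exact key (f := fun w => (w 3).1 - ((w 1).1 - (w 0).1 + (w 1).2 - (w 0).2)) (by fun_prop)
      (fun w h => (exp_relations h).2.1) (sub_eq_zero.2 hb.fst_three)
  · exact key (f := fun w => (w 3).2 - ((w 2).2 - (w 1).2)) (by fun_prop)
      (fun w h => (exp_relations h).2.2.1) (sub_eq_zero.2 hb.snd_three)
  · exact key (f := fun w => (w 4).1 - ((w 1).2 - (w 0).2)) (by fun_prop)
      (fun w h => (exp_relations h).2.2.2.1) (sub_eq_zero.2 hb.fst_four)
  · exact key (f := fun w => (w 4).2 - ((w 2).2 - (w 1).2 - (w 0).1)) (by fun_prop)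
      (fun w h => (exp_relations h).2.2.2.2) (sub_eq_zero.2 hb.snd_four)

lemma fiveTermSum_of_mem_FThat₀ {w : Fin 5 → ℂ × ℂ} (hw : w ∈ FThat₀) : fiveTermSum w = 0 := by
  rw [← fiveTermSum_basePt]
  exact fiveTermSum_const isPreconnected_FThat₀ (fun _ => isFlat_of_mem_FThat₀) hw
    (basePt_mem_FThat₀ hw)

/-- The deck transformations preserving `X₀₀` are the even ones. -/
lemma even_of_covAct_mem {w : ℂ × ℂ} (hw : w ∈ X00) {v : ℤ × ℤ} (h : covAct v w ∈ X00) :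
    ∃ a b : ℤ, v = (2 * a, 2 * b) := by
  have h0 := mem_X00_iff.1 hw
  have h1 := mem_X00_iff.1 h
  have hev : ∀ n : ℤ, Complex.exp (n * (Cpi * I)) = 1 → ∃ a, n = 2 * a := by
    intro n hn
    obtain ⟨a, ha⟩ := Complex.exp_eq_one_iff.1 hn
    refine ⟨a, ?_⟩
    have hpi : Cpi * I ≠ 0 := mul_ne_zero (by simp [Cpi, Real.pi_ne_zero]) I_ne_zero
    have : ((n : ℤ) : ℂ) = ((2 * a : ℤ) : ℂ) := by
      refine mul_right_cancel₀ hpi ?_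
      rw [ha, Cpi]
      push_cast
      ring
    exact_mod_cast this
  have e2 : -(covAct v w).2 = -w.2 + ((-v.2 : ℤ) : ℂ) * (Cpi * I) := by
    simp only [covAct]
    push_cast
    ring
  rw [e2, covAct, Complex.exp_add, Complex.exp_add] at h1
  have n1 := Complex.exp_ne_zero w.1
  have n2 := Complex.exp_ne_zero (-w.2)
  obtain ⟨p | p, q | q⟩ := And.intro (exp_int_mul_pi_I v.1) (exp_int_mul_pi_I (-v.2)) <;> rw [p, q] at h1
  · obtain ⟨a, ha⟩ := hev _ p
    obtain ⟨b, hb⟩ := hev _ q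
    exact ⟨a, -b, Prod.ext ha (by linarith)⟩
  · exact absurd (by linear_combination (h0 - h1) / 2) n2
  · exact absurd (by linear_combination (h0 - h1) / 2) n1
  · have : (2 : ℂ) = 0 := by linear_combination -(h0 + h1)
    norm_num at this

lemma fiveTermSum_of_mem_FThat {w : Fin 5 → ℂ × ℂ} (hw : w ∈ FThat) (hc : ∀ i, w i ∈ X00) :
    fiveTermSum w = 0 := by
  obtain ⟨w, hw, v, ⟨p₀, p₁, q₀, q₁, q₂, rfl⟩, rfl⟩ := hw
  have hF := isFlat_of_mem_FThat₀ hw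
  have hev := fun i => even_of_covAct_mem (hF.mem i) (hc i)
  choose a b hab using hev
  have hadd : ∀ i, RhatMod (covAct (2 * a i, 2 * b i) (w i)).1 (covAct (2 * a i, 2 * b i) (w i)).2 =
      RhatMod (w i).1 (w i).2 +
        QuotientAddGroup.mk (Cpi * I * (b i * (w i).1 - a i * (w i).2)) := by
    intro i
    rw [← RhatMod_add (mem_X00_iff.1 (hF.mem i))]
    simp [covAct]
  have h0 := hab 0
  have h1 := hab 1
  have h2 := hab 2
  have h3 := hab 3
  have h4 := hab 4
  simp only [Matrix.cons_val, Prod.mk.injEq] at h0 h1 h2 h3 h4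
  have c : ∀ m n : ℤ, m = n → (m : ℂ) = n := fun m n h => by rw [h]
  have a2 := c (a 2) (a 1 - a 0) (by omega)
  have a3 := c (a 3) (a 1 - a 0 + b 1 - b 0) (by omega)
  have b3 := c (b 3) (b 2 - b 1) (by omega)
  have a4 := c (a 4) (b 1 - b 0) (by omega)
  have b4 := c (b 4) (b 2 - b 1 - a 0) (by omega)
  push_cast at a2 a3 b3 a4 b4
  have hs := fiveTermSum_of_mem_FThat₀ hw
  rw [fiveTermSum_eq] at hs ⊢
  simp only [hab, hadd]
  have hz : Cpi * I * (b 0 * (w 0).1 - a 0 * (w 0).2) - Cpi * I * (b 1 * (w 1).1 - a 1 * (w 1).2) +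
      Cpi * I * (b 2 * (w 2).1 - a 2 * (w 2).2) - Cpi * I * (b 3 * (w 3).1 - a 3 * (w 3).2) +
      Cpi * I * (b 4 * (w 4).1 - a 4 * (w 4).2) = 0 := by
    rw [hF.fst_two, hF.fst_three, hF.snd_three, hF.fst_four, hF.snd_four, a2, a3, b3, a4, b4]
    ring
  have hz' := congrArg (QuotientAddGroup.mk : ℂ → Mod2PiSq) hz
  simp only [QuotientAddGroup.mk_add, QuotientAddGroup.mk_sub, QuotientAddGroup.mk_zero] at hz'
  rw [← add_zero (0 : Mod2PiSq)]
  nth_rewrite 1 [← hs]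
  rw [← hz']
  abel

/-- `R̂` gives a well-defined (continuous) map `X₀₀ → ℂ/2π²ℤ` whose value on the
sheet `(z;2p,2q)` is the branch value `R̂(z;2p,2q)`, it vanishes modulo `2π²ℤ` on every defining
relation of `êêP(ℂ)`, and it induces a homomorphism `R̂ : êêP(ℂ) → ℂ/2π²ℤ`. -/
theorem stmt10 :
    ∃ Rbar : X00T → Mod2PiSq,
      Continuous Rbar ∧
      (∀ (z : ℂ) (h : Reg z) (p q : ℤ),
        Rbar ⟨pt z (2 * p) (2 * q), pt_mem_X00 h p q⟩ = QuotientAddGroup.mk (Rhat z p q)) ∧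
      (∀ a ∈ FiveTermRels₀, FreeAbelianGroup.lift Rbar a = 0) ∧
      ∃ Rhom : EEPreBloch →+ Mod2PiSq,
        (∀ a : FreeAbelianGroup X00T,
          Rhom (QuotientAddGroup.mk a) = FreeAbelianGroup.lift Rbar a) ∧
        ∀ (z : ℂ), Reg z → ∀ (p q : ℤ),
          Rhom (cls₀ z p q) = QuotientAddGroup.mk (Rhat z p q) := by
  have hlift : ∀ a ∈ FiveTermRels₀,
      FreeAbelianGroup.lift (fun w : X00T => RhatMod w.1.1 w.1.2) a = 0 := by
    rintro _ ⟨w, hw, hc, rfl⟩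
    rw [map_sum, ← fiveTermSum_of_mem_FThat hw hc]
    simp only [map_zsmul, FreeAbelianGroup.lift_apply_of]
    rfl
  have hker : relSub₀ ≤ (FreeAbelianGroup.lift fun w : X00T => RhatMod w.1.1 w.1.2).ker :=
    (AddSubgroup.closure_le _).2 hlift
  refine ⟨fun w => RhatMod w.1.1 w.1.2, continuous_RhatMod, RhatMod_pt, hlift,
    QuotientAddGroup.lift relSub₀ _ hker, fun _ => rfl, fun z hz p q => ?_⟩
  rw [cls₀, dif_pos hz, QuotientAddGroup.lift_mk, genOf₀, FreeAbelianGroup.lift_apply_of]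
  exact RhatMod_pt z hz p q

end ExtendedBloch

end
end

section
/- For every point (x;p,q) ∈ 𝓒 one has, in êP(ℂ): [x,p,q] = pq·[x,1,1] - (pq-p)·[x,1,0] - (pq-q)·[x,0,1] + (pq-p-q+1)·[x,0,0], where [x,r,s] denotes the class of the point of 𝓒 lying over the same point of P with fiber coordinates (r,s). -/
open Complex
open scoped Classical

noncomputable section

namespace ExtendedBloch

/-- Second differences of the functions in a "separated" five term relation vanish. -/
lemma affine_of_separated_fiveTerm {M : Type*} [AddCommGroup M] (A B : Fin 5 → ℤ → M)
    (h : ∀ p₀ d q₀ e u : ℤ,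
      A 0 p₀ + B 0 q₀ - (A 1 (p₀ + d) + B 1 (q₀ + e)) + (A 2 d + B 2 (q₀ + e + u))
        - (A 3 (d + e) + B 3 u) + (A 4 e + B 4 (u - p₀)) = 0) (n : ℤ) :
    (A 0 (n + 1) - A 0 n = A 0 1 - A 0 0 ∧ B 0 (n + 1) - B 0 n = B 0 1 - B 0 0) ∧
      (A 1 (n + 1) - A 1 n = A 1 1 - A 1 0 ∧ B 1 (n + 1) - B 1 n = B 1 1 - B 1 0) := by
  have hA1 : A 1 (n + 1) - A 1 n = A 1 1 - A 1 0 := by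
    have e₁ := h n 1 0 0 0
    have e₂ := h n 0 0 0 0
    have e₃ := h 0 1 0 0 0
    have e₄ := h 0 0 0 0 0
    simp only [add_zero, zero_add, zero_sub, sub_zero] at e₁ e₂ e₃ e₄
    grind
  have hB4 (m : ℤ) : B 4 (m + 1) - B 4 m = B 4 1 - B 4 0 := by
    have e₁ := h (-1) 0 0 0 m
    have e₂ := h 0 0 0 0 m
    have e₃ := h (-1) 0 0 0 0
    have e₄ := h 0 0 0 0 0
    simp only [add_zero, zero_add, sub_zero, sub_neg_eq_add] at e₁ e₂ e₃ e₄
    grind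
  have hB2 : B 2 (n + 1) - B 2 n = B 2 1 - B 2 0 := by
    have e₁ := h 0 0 n 0 1
    have e₂ := h 0 0 n 0 0
    have e₃ := h 0 0 0 0 1
    have e₄ := h 0 0 0 0 0
    simp only [add_zero, zero_add, sub_zero] at e₁ e₂ e₃ e₄
    grind
  have hB1 : B 1 (n + 1) - B 1 n = B 1 1 - B 1 0 := by
    have e₁ := h 0 0 n 1 0
    have e₂ := h 0 0 n 0 0
    have e₃ := h 0 0 0 1 0
    have e₄ := h 0 0 0 0 0
    simp only [add_zero, zero_add, sub_zero] at e₁ e₂ e₃ e₄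
    grind
  refine ⟨⟨?_, ?_⟩, hA1, hB1⟩
  · have e₁ := h (n + 1) 0 0 0 0
    have e₂ := h n 0 0 0 0
    have e₃ := h 1 0 0 0 0
    have e₄ := h 0 0 0 0 0
    have b₁ := hB4 (-(n + 1))
    have b₂ := hB4 (-1)
    rw [show -(n + 1) + 1 = -n by ring] at b₁
    rw [show (-1 : ℤ) + 1 = 0 by ring] at b₂
    simp only [add_zero, zero_sub, sub_zero] at e₁ e₂ e₃ e₄
    grind
  · have e₁ := h 0 0 (n + 1) 0 0
    have e₂ := h 0 0 n 0 0
    have e₃ := h 0 0 1 0 0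
    have e₄ := h 0 0 0 0 0
    simp only [add_zero, sub_zero] at e₁ e₂ e₃ e₄
    grind

lemma eq_add_zsmul_of_sub_eq {M : Type*} [AddCommGroup M] (g : ℤ → M) (c : M)
    (h : ∀ n, g (n + 1) - g n = c) (n : ℤ) : g n = g 0 + n • c := by
  induction n using Int.induction_on with
  | zero => simp
  | succ k ih =>
    rw [← sub_add_cancel (g (k + 1)) (g k), h, ih, add_smul, one_smul]
    abel
  | pred k ih =>
    have := h (-k - 1)
    rw [sub_add_cancel, ih] at this
    rw [sub_smul, one_smul]
    grind

/-- A function on `ℤ × ℤ` satisfying the transfer relation and affine in each variable after a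
shift is determined by its values on `{0,1}²`. -/
lemma eq_of_transfer_of_affine {M : Type*} [AddCommGroup M] (f : ℤ → ℤ → M)
    (ht : ∀ p q p' q', f p q + f p' q' = f p q' + f p' q) (a b : ℤ)
    (hp : ∀ n, f (a + (n + 1)) b - f (a + n) b = f (a + 1) b - f a b)
    (hq : ∀ n, f a (b + (n + 1)) - f a (b + n) = f a (b + 1) - f a b) (p q : ℤ) :
    f p q = (p * q) • f 1 1 - (p * q - p) • f 1 0 - (p * q - q) • f 0 1 +
      (p * q - p - q + 1) • f 0 0 := by
  have hp' : f p 0 = f 0 0 + p • (f 1 0 - f 0 0) := by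
    refine eq_add_zsmul_of_sub_eq (fun n => f n 0) _ (fun n => ?_) p
    have e₁ := hp (n - a)
    have e₂ := hp (0 - a)
    rw [show a + (n - a + 1) = n + 1 by ring, show a + (n - a) = n by ring] at e₁
    rw [show a + (0 - a + 1) = 1 by ring, show a + (0 - a) = 0 by ring] at e₂
    have t₁ := ht (n + 1) 0 n b
    have t₂ := ht 1 0 0 b
    grind
  have hq' : f 0 q = f 0 0 + q • (f 0 1 - f 0 0) := by
    refine eq_add_zsmul_of_sub_eq (fun n => f 0 n) _ (fun n => ?_) q
    have e₁ := hq (n - b)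
    have e₂ := hq (0 - b)
    rw [show b + (n - b + 1) = n + 1 by ring, show b + (n - b) = n by ring] at e₁
    rw [show b + (0 - b + 1) = 1 by ring, show b + (0 - b) = 0 by ring] at e₂
    have t₁ := ht 0 (n + 1) a n
    have t₂ := ht 0 1 a 0
    grind
  have h₁₁ : f 1 1 = f 1 0 + f 0 1 - f 0 0 := eq_sub_of_add_eq (ht 1 1 0 0)
  have hpq : f p q = f p 0 + f 0 q - f 0 0 := eq_sub_of_add_eq (ht p q 0 0)
  rw [hpq, hp', hq', h₁₁]
  module

lemma cls_of_reg {z : ℂ} (h : Reg z) (p q : ℤ) :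
    cls z p q = QuotientAddGroup.mk (genOf z h p q) := dif_pos h

lemma cls_transfer {z : ℂ} (h : Reg z) (p q p' q' : ℤ) :
    cls z p q + cls z p' q' = cls z p q' + cls z p' q := by
  simp only [cls_of_reg h, ← QuotientAddGroup.mk_add]
  rw [← sub_eq_zero, ← QuotientAddGroup.mk_sub, QuotientAddGroup.eq_zero_iff]
  refine AddSubgroup.subset_closure (Or.inr ⟨z, h, p, q, p', q', ?_⟩)
  abel

lemma covAct_pt (z : ℂ) (p q : ℤ) (v : ℤ × ℤ) :
    covAct v (pt z p q) = pt z (p + v.1) (q + v.2) := by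
  simp only [covAct, pt, Prod.mk.injEq]
  push_cast
  constructor <;> ring

lemma cls_fiveTerm {v : Fin 5 → ℂ} {P Q : Fin 5 → ℤ} (hv : ∀ i, Reg (v i))
    (hw : (fun i => pt (v i) (P i) (Q i)) ∈ FThat₀) {s : Fin 5 → ℤ × ℤ} (hs : s ∈ Vset) :
    ∑ i : Fin 5, (-1 : ℤ) ^ (i : ℕ) • cls (v i) (P i + (s i).1) (Q i + (s i).2) = 0 := by
  have hrel : ∑ i : Fin 5, (-1 : ℤ) ^ (i : ℕ) •
      genOf (v i) (hv i) (P i + (s i).1) (Q i + (s i).2) ∈ relSub := by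
    refine AddSubgroup.subset_closure (Or.inl
      ⟨fun i => pt (v i) (P i + (s i).1) (Q i + (s i).2), ⟨_, hw, s, hs, ?_⟩,
        fun i => pt_mem_Cover (hv i) _ _, rfl⟩)
    exact funext fun i => (covAct_pt _ _ _ _).symm
  rw [← QuotientAddGroup.eq_zero_iff] at hrel
  rw [← hrel, ← QuotientAddGroup.mk'_apply, map_sum]
  simp only [map_zsmul, QuotientAddGroup.mk'_apply, cls_of_reg (hv _)]

lemma cls_eq_of_mem_FThat₀ {v : Fin 5 → ℂ} {w : Fin 5 → ℂ × ℂ} (hw : w ∈ FThat₀)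
    (hl : ∀ i, LiesOver (w i) (v i)) {i : Fin 5} (hi : i = 0 ∨ i = 1) (p q : ℤ) :
    cls (v i) p q = (p * q) • cls (v i) 1 1 - (p * q - p) • cls (v i) 1 0 -
      (p * q - q) • cls (v i) 0 1 + (p * q - p - q + 1) • cls (v i) 0 0 := by
  choose hv P Q hPQ using hl
  obtain rfl : w = fun i => pt (v i) (P i) (Q i) := funext hPQ
  have key := affine_of_separated_fiveTerm
    (fun i n => cls (v i) (P i + n) (Q i))
    (fun i n => cls (v i) (P i) (Q i + n) - cls (v i) (P i) (Q i)) (fun p₀ d q₀ e u => by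
      have hV : ![(p₀, q₀), (p₀ + d, q₀ + e), (d, q₀ + e + u), (d + e, u), (e, u - p₀)] ∈ Vset := by
        refine ⟨p₀, p₀ + d, q₀, q₀ + e, q₀ + e + u, ?_⟩
        ext j <;> fin_cases j <;> simp <;> ring
      have h := cls_fiveTerm hv hw hV
      have split (i : Fin 5) (m n : ℤ) : cls (v i) (P i + m) (Q i + n) =
          cls (v i) (P i + m) (Q i) + (cls (v i) (P i) (Q i + n) - cls (v i) (P i) (Q i)) := by
        have := cls_transfer (hv i) (P i + m) (Q i + n) (P i) (Q i)
        grind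
      simp only [split] at h
      rw [← h]
      simp only [Fin.sum_univ_five, Matrix.cons_val, Fin.coe_ofNat_eq_mod]
      norm_num
      abel)
  simp only [add_zero, sub_self, sub_zero, sub_sub_sub_cancel_right] at key
  refine eq_of_transfer_of_affine (cls (v i)) (cls_transfer (hv i)) (P i) (Q i) ?_ ?_ p q
  · rcases hi with rfl | rfl
    exacts [fun n => (key n).1.1, fun n => (key n).2.1]
  · rcases hi with rfl | rfl
    exacts [fun n => (key n).1.2, fun n => (key n).2.2]

lemma reg_ftTuple {x y : ℂ} (hx : Reg x) (hy : Reg y) (hxy : x ≠ y) (i : Fin 5) :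
    Reg (ftTuple x y i) := by
  obtain ⟨hx0, hx1⟩ := hx
  obtain ⟨hy0, hy1⟩ := hy
  have hx1' : 1 - x ≠ 0 := sub_ne_zero.mpr hx1.symm
  have hy1' : 1 - y ≠ 0 := sub_ne_zero.mpr hy1.symm
  have hxi : 1 - x⁻¹ ≠ 0 := sub_ne_zero.mpr fun h => hx1 (inv_eq_one.mp h.symm)
  have hyi : 1 - y⁻¹ ≠ 0 := sub_ne_zero.mpr fun h => hy1 (inv_eq_one.mp h.symm)
  fin_cases i
  · exact ⟨hx0, hx1⟩
  · exact ⟨hy0, hy1⟩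
  · exact ⟨div_ne_zero hy0 hx0, fun h => hxy ((div_eq_one_iff_eq hx0).mp h).symm⟩
  · refine ⟨div_ne_zero hxi hyi, fun h => hxy ?_⟩
    exact inv_injective (sub_right_injective ((div_eq_one_iff_eq hyi).mp h))
  · refine ⟨div_ne_zero hx1' hy1', fun h => hxy ?_⟩
    exact sub_right_injective ((div_eq_one_iff_eq hy1').mp h)

lemma liesOver_pt_add {z₀ z a b : ℂ} (h₀ : Reg z₀) (ha : z = z₀ * exp a)
    (hb : 1 - z = (1 - z₀) * exp b) : LiesOver (pt z₀ 0 0 + (a, -b)) z := by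
  have hz₀ : 1 - z₀ ≠ 0 := sub_ne_zero.mpr h₀.2.symm
  have hz : z ≠ 0 := ha ▸ mul_ne_zero h₀.1 (exp_ne_zero _)
  have hz' : 1 - z ≠ 0 := hb ▸ mul_ne_zero hz₀ (exp_ne_zero _)
  have e₁ : exp (log z₀ + a) = exp (log z) := by
    rw [exp_add, exp_log h₀.1, exp_log hz, ha]
  have e₂ : exp (log (1 - z₀) + b) = exp (log (1 - z)) := by
    rw [exp_add, exp_log hz₀, exp_log hz', hb]
  obtain ⟨m, hm⟩ := exp_eq_exp_iff_exists_int.mp e₁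
  obtain ⟨n, hn⟩ := exp_eq_exp_iff_exists_int.mp e₂
  refine ⟨⟨hz, (sub_ne_zero.mp hz').symm⟩, 2 * m, -(2 * n), ?_⟩
  simp only [pt, Cpi, Prod.mk_add_mk, Prod.mk.injEq]
  push_cast
  constructor
  · linear_combination hm
  · linear_combination -hn

/-- Translating the lift of `ftTuple x y` in `𝓒⁵` by logarithms of the ratios
`x'/x`, `(1-x')/(1-x)`, `y'/y`, `(1-y')/(1-y)`, `(y'-x')/(y-x)`. -/
def ftShift (x y a b c d e : ℂ) : Fin 5 → ℂ × ℂ := fun i =>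
  pt (ftTuple x y i) 0 0 +
    (![a, c, c - a, b + c - a - d, b - d] i, -![b, d, e - a, e - a - d, e - d] i)

lemma liesOver_ftShift {x y x' y' a b c d e : ℂ} (hx : Reg x) (hy : Reg y) (hxy : x ≠ y)
    (ha : x' = x * exp a) (hb : 1 - x' = (1 - x) * exp b) (hc : y' = y * exp c)
    (hd : 1 - y' = (1 - y) * exp d) (he : y' - x' = (y - x) * exp e) (i : Fin 5) :
    LiesOver (ftShift x y a b c d e i) (ftTuple x' y' i) := by
  have hx1 : 1 - x ≠ 0 := sub_ne_zero.mpr hx.2.symm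
  have hy1 : 1 - y ≠ 0 := sub_ne_zero.mpr hy.2.symm
  have hx' : x' ≠ 0 := ha ▸ mul_ne_zero hx.1 (exp_ne_zero _)
  have hy' : y' ≠ 0 := hc ▸ mul_ne_zero hy.1 (exp_ne_zero _)
  have hy1' : 1 - y' ≠ 0 := hd ▸ mul_ne_zero hy1 (exp_ne_zero _)
  have hx0 := hx.1
  have hy0 := hy.1
  have third {u v : ℂ} (hu : u ≠ 0) (hv : v ≠ 0) (hv1 : 1 - v ≠ 0) :
      (1 - u⁻¹) / (1 - v⁻¹) = (1 - u) * v / (u * (1 - v)) := by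
    have h : 1 - v⁻¹ = -(1 - v) / v := by field_simp; ring
    rw [h]
    field_simp
    ring
  have third' {u v : ℂ} (hu : u ≠ 0) (hv : v ≠ 0) (hv1 : 1 - v ≠ 0) :
      1 - (1 - u⁻¹) / (1 - v⁻¹) = -(v - u) / (u * (1 - v)) := by
    rw [third hu hv hv1]
    field_simp
    ring
  have second {u v : ℂ} (hu : u ≠ 0) : 1 - v / u = -(v - u) / u := by field_simp; ring
  have fourth {u v : ℂ} (hv : 1 - v ≠ 0) : 1 - (1 - u) / (1 - v) = -(v - u) / (1 - v) := by
    field_simp; ring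
  refine liesOver_pt_add (reg_ftTuple hx hy hxy i) ?_ ?_ <;> fin_cases i <;>
    simp only [ftTuple, Fin.zero_eta, Fin.mk_one, Fin.reduceFinMk, Matrix.cons_val]
  · exact ha
  · exact hc
  · rw [exp_sub, hc, ha]
    field_simp
  · rw [third hx' hy' hy1', third hx0 hy0 hy1, exp_sub, exp_sub, exp_add, hb, hd, hc, ha]
    field_simp
  · rw [exp_sub, hb, hd]
    field_simp
  · exact hb
  · exact hd
  · rw [second hx', second hx0, exp_sub, he, ha]
    field_simp
  · rw [third' hx' hy' hy1', third' hx0 hy0 hy1, exp_sub, exp_sub, he, hd, ha]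
    field_simp
  · rw [fourth hy1', fourth hy1, exp_sub, he, hd]
    field_simp

/-- The logarithm of `(1 - t) + t r`, where `r` is the ratio of the end values of an affine
function. -/
def segLog (r : ℂ) (t : ℝ) : ℂ := log (1 + t * (r - 1))

lemma one_add_mul_mem_slitPlane {r : ℂ} (hr : r ∈ slitPlane) {t : ℝ}
    (ht : t ∈ Set.Icc (0 : ℝ) 1) : 1 + (t : ℂ) * (r - 1) ∈ slitPlane := by
  have := starConvex_one_slitPlane hr (sub_nonneg.mpr ht.2) ht.1 (sub_add_cancel 1 t)
  convert this using 1
  simp only [real_smul]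
  push_cast
  ring

lemma continuousOn_segLog {r : ℂ} (hr : r ∈ slitPlane) :
    ContinuousOn (segLog r) (Set.Icc 0 1) := by
  refine ContinuousOn.clog (by fun_prop) fun t ht => one_add_mul_mem_slitPlane hr ht

lemma mul_exp_segLog {u u' : ℂ} (hu : u ≠ 0) (hr : u' / u ∈ slitPlane) {t : ℝ}
    (ht : t ∈ Set.Icc (0 : ℝ) 1) : u * exp (segLog (u' / u) t) = u + t * (u' - u) := by
  rw [segLog, exp_log (slitPlane_ne_zero (one_add_mul_mem_slitPlane hr ht))]
  field_simp

lemma exists_mem_FThat₀ {x' y' : ℂ}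
    (ha : x' / ((1 + I) / 4) ∈ slitPlane) (hb : (1 - x') / (1 - (1 + I) / 4) ∈ slitPlane)
    (hc : y' / I ∈ slitPlane) (hd : (1 - y') / (1 - I) ∈ slitPlane)
    (he : (y' - x') / (I - (1 + I) / 4) ∈ slitPlane) :
    ∃ w ∈ FThat₀, ∀ i, LiesOver (w i) (ftTuple x' y' i) := by
  set x : ℂ := (1 + I) / 4 with hxdef
  have hx : Reg x := by
    constructor <;> intro h <;> have := congrArg Complex.im h <;> norm_num [hxdef] at this
  have hy : Reg I := by
    constructor <;> intro h <;> have := congrArg Complex.im h <;> norm_num at this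
  have hxy : x ≠ I := by
    intro h
    have := congrArg Complex.im h
    norm_num [hxdef] at this
  have hx1 : 1 - x ≠ 0 := sub_ne_zero.mpr hx.2.symm
  have hy1 : 1 - I ≠ 0 := sub_ne_zero.mpr hy.2.symm
  have hxy' : I - x ≠ 0 := sub_ne_zero.mpr hxy.symm
  let γ : ℝ → Fin 5 → ℂ × ℂ := fun t => ftShift x I (segLog (x' / x) t)
    (segLog ((1 - x') / (1 - x)) t) (segLog (y' / I) t) (segLog ((1 - y') / (1 - I)) t)
    (segLog ((y' - x') / (I - x)) t)
  have hl : ∀ t ∈ Set.Icc (0 : ℝ) 1, ∀ i,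
      LiesOver (γ t i) (ftTuple (x + t * (x' - x)) (I + t * (y' - I)) i) := by
    intro t ht
    apply liesOver_ftShift hx hy hxy
    · rw [mul_exp_segLog hx.1 ha ht]
    · rw [mul_exp_segLog hx1 hb ht]
      ring
    · rw [mul_exp_segLog hy.1 hc ht]
    · rw [mul_exp_segLog hy1 hd ht]
      ring
    · rw [mul_exp_segLog hxy' he ht]
      ring
  have hγ : ContinuousOn γ (Set.Icc 0 1) := by
    have ca := continuousOn_segLog ha
    have cb := continuousOn_segLog hb
    have cc := continuousOn_segLog hc
    have cd := continuousOn_segLog hd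
    have ce := continuousOn_segLog he
    refine continuousOn_pi.mpr fun i => continuousOn_const.add (ContinuousOn.prodMk ?_ ?_) <;>
      fin_cases i <;>
      simp only [Fin.zero_eta, Fin.mk_one, Fin.reduceFinMk, Matrix.cons_val] <;> fun_prop
  have hsub : γ '' Set.Icc 0 1 ⊆ FTpre := by
    rintro _ ⟨t, ht, rfl⟩
    refine ⟨_, ⟨x + t * (x' - x), I + t * (y' - I), (hl t ht 0).1, (hl t ht 1).1,
      fun h => ?_, rfl⟩, hl t ht⟩
    refine mul_ne_zero hxy' (exp_ne_zero (segLog ((y' - x') / (I - x)) t)) ?_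
    rw [mul_exp_segLog hxy' he ht]
    linear_combination -h
  have h₀ : γ 0 = basePt := by
    funext i
    simp only [γ, ftShift, segLog, basePt, ofReal_zero, zero_mul, add_zero, log_one, sub_zero]
    fin_cases i <;> simp [hxdef]
  refine ⟨γ 1, (isPreconnected_Icc.image γ hγ).subset_connectedComponentIn
    ⟨0, by simp, h₀⟩ hsub ⟨1, by simp, rfl⟩, ?_⟩
  simpa using hl 1 (by simp)

lemma exists_liesOver_mem_FThat₀ {z : ℂ} (hz : Reg z) :
    ∃ v : Fin 5 → ℂ, ∃ w ∈ FThat₀, (∀ i, LiesOver (w i) (v i)) ∧ (v 0 = z ∨ v 1 = z) := by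
  have hx : ((1 + I) / 4 : ℂ) ≠ 0 := fun h => by
    have := congrArg Complex.im h
    norm_num at this
  have hx1 : (1 - (1 + I) / 4 : ℂ) ≠ 0 := fun h => by
    have := congrArg Complex.im h
    norm_num at this
  have hy1 : (1 - I : ℂ) ≠ 0 := fun h => by
    have := congrArg Complex.im h
    norm_num at this
  have hxy : (I - (1 + I) / 4 : ℂ) ≠ 0 := fun h => by
    have := congrArg Complex.im h
    norm_num at this
  by_cases h : z / I ∈ slitPlane ∧ (1 - z) / (1 - I) ∈ slitPlane ∧
      (z - (1 + I) / 4) / (I - (1 + I) / 4) ∈ slitPlane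
  · obtain ⟨w, hw, hl⟩ := exists_mem_FThat₀ (x' := (1 + I) / 4) (y' := z)
      (by simp [div_self hx]) (by simp [div_self hx1]) h.1 h.2.1 h.2.2
    exact ⟨_, w, hw, hl, Or.inr rfl⟩
  · obtain ⟨w, hw, hl⟩ : ∃ w ∈ FThat₀, ∀ i, LiesOver (w i) (ftTuple z I i) := by
      obtain ⟨hz0, hz1⟩ := hz
      rw [Ne, Complex.ext_iff] at hz0 hz1
      norm_num at hz0 hz1
      refine exists_mem_FThat₀ ?_ ?_ (by simp)
        (by simp [div_self hy1]) ?_ <;>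
      · contrapose! h
        simp only [mem_slitPlane_iff, div_re, div_im, normSq_apply, not_or, not_lt, not_not] at h ⊢
        norm_num at h ⊢
        grind
    exact ⟨_, w, hw, hl, Or.inl rfl⟩

/-- in `êP(ℂ)`,
`[x,p,q] = pq[x,1,1] - (pq-p)[x,1,0] - (pq-q)[x,0,1] + (pq-p-q+1)[x,0,0]`. -/
theorem stmt11 (x : ℂ) (h0 : x ≠ 0) (h1 : x ≠ 1) (p q : ℤ) :
    cls x p q = (p * q) • cls x 1 1 - (p * q - p) • cls x 1 0 - (p * q - q) • cls x 0 1 +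
      (p * q - p - q + 1) • cls x 0 0 := by
  obtain ⟨v, w, hw, hl, rfl | rfl⟩ := exists_liesOver_mem_FThat₀ ⟨h0, h1⟩
  exacts [cls_eq_of_mem_FThat₀ hw hl (Or.inl rfl) p q,
    cls_eq_of_mem_FThat₀ hw hl (Or.inr rfl) p q]

end ExtendedBloch

end
end
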